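/- arXiv:1712.01499 — 12 statements merged into one kernel-verified Lean document; each statement's English description precedes it below -/
import Mathlib

section
/- An element x* ∈ X is a minimizer over X of the Tikhonov functional T_α^δ(x) = (1/p)‖A x − y^δ‖^p + α Ω(x) if and only if there exists η ∈ Y* such that ⟨η, A x* − y^δ⟩ = −‖η‖·‖A x* − y^δ‖, α·‖η‖ = ‖A x* − y^δ‖^{p−1}, and A*η ∈ ∂Ω(x*). -/
open Filter Topology Set

noncomputable section

variable {X Y : Type*} [NormedAddCommGroup X] [NormedSpace ℝ X] [CompleteSpace X]
  [NormedAddCommGroup Y] [NormedSpace ℝ Y] [CompleteSpace Y]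

/-- `Ω : X → (-∞,∞]` is proper: it never takes the value `−∞ = ⊥`
and is finite somewhere. -/
def IsProper (Ω : X → EReal) : Prop := (∀ x, Ω x ≠ ⊥) ∧ ∃ x, Ω x ≠ ⊤

/-- Convexity of an extended-real-valued functional. -/
def IsConvexFn (Ω : X → EReal) : Prop :=
  ∀ x y : X, ∀ a b : ℝ, 0 ≤ a → 0 ≤ b → a + b = 1 →
    Ω (a • x + b • y) ≤ (a : EReal) * Ω x + (b : EReal) * Ω y

/-- `ξ ∈ ∂Ω(xb)`: `ξ` is a subgradient of `Ω` at `xb`. -/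
def IsSubgradient (Ω : X → EReal) (xb : X) (ξ : X →L[ℝ] ℝ) : Prop :=
  ∀ x, Ω xb + (ξ (x - xb) : EReal) ≤ Ω x

/-- Bregman distance `B^Ω_ξ(x, xb) = Ω(x) − Ω(xb) − ⟨ξ, x − xb⟩`. -/
def Bregman (Ω : X → EReal) (ξ : X →L[ℝ] ℝ) (x xb : X) : EReal :=
  Ω x - Ω xb - (ξ (x - xb) : EReal)

/-- The Tikhonov functional `T_α^δ(x) = (1/p)‖A x − yδ‖^p + α Ω(x)`. -/
def Tikhonov (A : X →L[ℝ] Y) (yδ : Y) (p α : ℝ) (Ω : X → EReal) (x : X) : EReal :=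
  ((1 / p * ‖A x - yδ‖ ^ p : ℝ) : EReal) + (α : EReal) * Ω x

/-- `xdag` is an `Ω`-minimizing solution of `A x = yd`. -/
def IsOmegaMinSol (A : X →L[ℝ] Y) (yd : Y) (Ω : X → EReal) (xdag : X) : Prop :=
  A xdag = yd ∧ Ω xdag ≠ ⊤ ∧ ∀ x, A x = yd → Ω xdag ≤ Ω x

/-- The distance function `D(r) = sup_{x ∈ X} (Ω(x†) − Ω(x) − r‖A x − A x†‖)`,
with values in `[0, ∞]` (as an `EReal`-valued supremum). -/
def distFun (A : X →L[ℝ] Y) (Ω : X → EReal) (xdag : X) (r : ℝ) : EReal :=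
  ⨆ x : X, (Ω xdag - Ω x - ((r * ‖A x - A xdag‖ : ℝ) : EReal))

/-- An index function `φ : [0,∞) → [0,∞)`: continuous, monotonically increasing,
strictly increasing in a neighborhood of zero, and `φ(0) = 0`. -/
def IsIndexFun (φ : ℝ → ℝ) : Prop :=
  ContinuousOn φ (Set.Ici 0) ∧ MonotoneOn φ (Set.Ici 0) ∧
    (∃ ε > 0, StrictMonoOn φ (Set.Icc 0 ε)) ∧ φ 0 = 0 ∧ ∀ t, 0 ≤ t → 0 ≤ φ t

/-- First-order optimality data for the Tikhonov minimizer `xs`: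
`⟨η, A xs − yδ⟩ = −‖η‖‖A xs − yδ‖`, `α‖η‖ = ‖A xs − yδ‖^(p−1)` and
`A*η ∈ ∂Ω(xs)`, where `A*η = η ∘ A`. -/
def EtaCondition (A : X →L[ℝ] Y) (yδ : Y) (p α : ℝ) (Ω : X → EReal)
    (xs : X) (η : Y →L[ℝ] ℝ) : Prop :=
  η (A xs - yδ) = -(‖η‖ * ‖A xs - yδ‖) ∧
    α * ‖η‖ = ‖A xs - yδ‖ ^ (p - 1) ∧
    IsSubgradient Ω xs (η.comp A)

/-- The tangent line inequality for `t ↦ t ^ p / p` on `[0, ∞)`. -/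
theorem rpow_sub_one_mul_sub_le {p q r : ℝ} (hp : 1 < p) (hq : 0 ≤ q) (hr : 0 ≤ r) :
    q ^ (p - 1) * (r - q) ≤ 1 / p * r ^ p - 1 / p * q ^ p := by
  have hpq : p.HolderConjugate (p / (p - 1)) := Real.HolderConjugate.conjExponent hp
  have h := Real.young_inequality_of_nonneg hr (Real.rpow_nonneg hq (p - 1)) hpq
  have h1 : (q ^ (p - 1)) ^ (p / (p - 1)) = q ^ p := by
    rw [← Real.rpow_mul hq, mul_div_cancel₀ _ (by linarith : p - 1 ≠ 0)]
  have h2 : q ^ (p - 1) * q = q ^ p := by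
    rw [← Real.rpow_add_one' hq (by linarith), sub_add_cancel]
  have h3 : q ^ p / (p / (p - 1)) = q ^ p - 1 / p * q ^ p := by
    have : p - 1 ≠ 0 := by linarith
    field_simp
  rw [h1, h3] at h
  linarith [mul_sub (q ^ (p - 1)) r q, mul_comm r (q ^ (p - 1)), div_eq_mul_one_div (r ^ p) p,
    mul_comm (r ^ p) (1 / p)]

theorem convexOn_norm_rpow_div {E : Type*} [NormedAddCommGroup E] [NormedSpace ℝ E] {p : ℝ}
    (hp : 1 < p) : ConvexOn ℝ univ fun y : E => 1 / p * ‖y‖ ^ p := by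
  refine ConvexOn.smul (c := 1 / p) (by positivity) ⟨convex_univ, fun x _ y _ a b ha hb hab => ?_⟩
  calc ‖a • x + b • y‖ ^ p ≤ (a • ‖x‖ + b • ‖y‖) ^ p := by
        refine Real.rpow_le_rpow (norm_nonneg _) ?_ (by linarith)
        exact convexOn_univ_norm.2 (mem_univ x) (mem_univ y) ha hb hab
    _ ≤ _ := (convexOn_rpow hp.le).2 (norm_nonneg x) (norm_nonneg y) ha hb hab

/-- Every subgradient `ζ` of `(1 / p) * ‖·‖ ^ p` at `y₀` satisfies `‖ζ‖ = ‖y₀‖ ^ (p - 1)` and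
`ζ y₀ = ‖ζ‖ * ‖y₀‖`. -/
theorem norm_eq_and_apply_eq_of_subgradient_norm_rpow {E : Type*} [NormedAddCommGroup E]
    [NormedSpace ℝ E] {p : ℝ} (hp : 1 < p) {y₀ : E} {ζ : E →L[ℝ] ℝ}
    (hζ : ∀ y, ζ (y - y₀) ≤ 1 / p * ‖y‖ ^ p - 1 / p * ‖y₀‖ ^ p) :
    ‖ζ‖ = ‖y₀‖ ^ (p - 1) ∧ ζ y₀ = ‖ζ‖ * ‖y₀‖ := by
  have hp0 : 0 < p := by linarith
  have hnn : 0 ≤ ‖y₀‖ ^ (p - 1) := by positivity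
  have hpow : ‖y₀‖ ^ (p - 1) * ‖y₀‖ = ‖y₀‖ ^ p := by
    rw [← Real.rpow_add_one' (norm_nonneg _) (by linarith), sub_add_cancel]
  have upper (w : E) : ζ w ≤ ‖y₀‖ ^ (p - 1) * ‖w‖ := by
    have hlim : Tendsto (fun t : ℝ => (‖y₀‖ + t * ‖w‖) ^ (p - 1) * ‖w‖) (𝓝[>] 0)
        (𝓝 (‖y₀‖ ^ (p - 1) * ‖w‖)) := by
      have hc : Continuous fun t : ℝ => (‖y₀‖ + t * ‖w‖) ^ (p - 1) * ‖w‖ :=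
        ((by fun_prop : Continuous fun t : ℝ => ‖y₀‖ + t * ‖w‖).rpow_const
          fun _ => Or.inr (by linarith)).mul_const _
      simpa using (hc.tendsto 0).mono_left nhdsWithin_le_nhds
    refine ge_of_tendsto hlim ?_
    filter_upwards [self_mem_nhdsWithin] with t (ht : 0 < t)
    have h1 := hζ (y₀ + t • w)
    rw [add_sub_cancel_left, map_smul, smul_eq_mul] at h1
    have h2 : ‖y₀ + t • w‖ ^ p ≤ (‖y₀‖ + t * ‖w‖) ^ p := by
      refine Real.rpow_le_rpow (norm_nonneg _) ((norm_add_le _ _).trans_eq ?_) hp0.le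
      rw [norm_smul, Real.norm_of_nonneg ht.le]
    have h3 := rpow_sub_one_mul_sub_le hp (by positivity : 0 ≤ ‖y₀‖ + t * ‖w‖) (norm_nonneg y₀)
    have h4 := mul_le_mul_of_nonneg_left h2 (by positivity : 0 ≤ 1 / p)
    refine le_of_mul_le_mul_left ?_ ht
    linarith
  have lower : ‖y₀‖ ^ p ≤ ζ y₀ := by
    have hlim : Tendsto (fun t : ℝ => ((1 - t) * ‖y₀‖) ^ (p - 1) * ‖y₀‖) (𝓝[>] 0)
        (𝓝 (‖y₀‖ ^ p)) := by
      have hc : Continuous fun t : ℝ => ((1 - t) * ‖y₀‖) ^ (p - 1) * ‖y₀‖ :=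
        ((by fun_prop : Continuous fun t : ℝ => (1 - t) * ‖y₀‖).rpow_const
          fun _ => Or.inr (by linarith)).mul_const _
      simpa [hpow] using (hc.tendsto 0).mono_left nhdsWithin_le_nhds
    refine le_of_tendsto hlim ?_
    filter_upwards [Ioo_mem_nhdsGT (zero_lt_one' ℝ)] with t ht
    have ht1 : 0 ≤ 1 - t := by linarith [ht.2]
    have h1 := hζ ((1 - t) • y₀)
    rw [map_sub, map_smul, smul_eq_mul, norm_smul, Real.norm_of_nonneg ht1] at h1
    have h3 := rpow_sub_one_mul_sub_le hp (by positivity : 0 ≤ (1 - t) * ‖y₀‖) (norm_nonneg y₀)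
    refine le_of_mul_le_mul_left ?_ ht.1
    linarith
  have hle : ‖ζ‖ ≤ ‖y₀‖ ^ (p - 1) := by
    refine ζ.opNorm_le_bound hnn fun w => abs_le.2 ⟨?_, upper w⟩
    have := upper (-w)
    rw [map_neg, norm_neg] at this
    linarith
  have hbound : ζ y₀ ≤ ‖ζ‖ * ‖y₀‖ := (le_abs_self _).trans (ζ.le_opNorm y₀)
  have hge : ‖y₀‖ ^ (p - 1) ≤ ‖ζ‖ := by
    rcases (norm_nonneg y₀).eq_or_lt with h0 | h0
    · rw [← h0, Real.zero_rpow (by linarith)]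
      exact norm_nonneg ζ
    · exact le_of_mul_le_mul_right (by linarith) h0
  have heq := le_antisymm hle hge
  exact ⟨heq, le_antisymm hbound (by rw [heq, hpow]; exact lower)⟩

/-- A sum rule at a minimizer: if `f` is convex and continuous on `F`, the set `C ⊆ F × ℝ` is convex
and contains `(y₀, c₀)`, and `(y, c) ↦ f y + c` is minimized over `C` at `(y₀, c₀)`, then some
subgradient `ζ` of `f` at `y₀` satisfies `c₀ - ζ (y - y₀) ≤ c` for all `(y, c) ∈ C`. -/
theorem exists_subgradient_of_isMinOn {F : Type*} [NormedAddCommGroup F] [NormedSpace ℝ F]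
    {f : F → ℝ} (hf : ConvexOn ℝ univ f) (hfc : Continuous f) {C : Set (F × ℝ)}
    (hC : Convex ℝ C) {y₀ : F} {c₀ : ℝ} (h₀ : (y₀, c₀) ∈ C)
    (hmin : ∀ z ∈ C, f y₀ + c₀ ≤ f z.1 + z.2) :
    ∃ ζ : F →L[ℝ] ℝ, (∀ y, ζ (y - y₀) ≤ f y - f y₀) ∧ ∀ z ∈ C, c₀ - ζ (z.1 - y₀) ≤ z.2 := by
  set L : F × ℝ →ₗ[ℝ] F × ℝ := LinearMap.prodMap LinearMap.id (-LinearMap.id) with hL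
  have hdisj : Disjoint {z : F × ℝ | z.1 ∈ univ ∧ f z.1 < z.2}
      ((fun z => (0, f y₀ + c₀) + z) '' (L '' C)) := by
    rw [Set.disjoint_left]
    rintro _ ⟨-, h⟩ ⟨_, ⟨z, hz, rfl⟩, rfl⟩
    have := hmin z hz
    simp [hL] at h
    linarith
  obtain ⟨φ, u, h1, h2⟩ := geometric_hahn_banach_open hf.convex_strict_epigraph
    (by simpa using isOpen_lt (hfc.comp continuous_fst) continuous_snd)
    ((hC.linear_image L).translate _) hdisj
  set g : F →L[ℝ] ℝ := φ.comp (ContinuousLinearMap.inl ℝ F ℝ) with hg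
  set c : ℝ := φ (0, 1) with hc
  have hφ (y : F) (t : ℝ) : φ (y, t) = g y + t * c := by
    have : (y, t) = (y, (0 : ℝ)) + t • ((0 : F), (1 : ℝ)) := by simp
    rw [this, map_add, map_smul]
    rfl
  have hepi (y : F) (t : ℝ) (ht : f y < t) : g y + t * c < u := by
    rw [← hφ]
    exact h1 _ ⟨mem_univ _, ht⟩
  have hCu (z : F × ℝ) (hz : z ∈ C) : u ≤ g z.1 + (f y₀ + c₀ - z.2) * c := by
    have := h2 _ ⟨_, ⟨z, hz, rfl⟩, rfl⟩
    rw [← hφ]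
    simpa [hL, sub_eq_add_neg] using this
  have hu := hCu _ h₀
  have hcneg : c < 0 := by
    have := hepi y₀ (f y₀ + 1) (by linarith)
    simp only at hu
    linarith
  have hepi' (y : F) : g y + f y * c ≤ u := by
    have hlim : Tendsto (fun t : ℝ => g y + t * c) (𝓝[>] (f y)) (𝓝 (g y + f y * c)) :=
      ((by fun_prop : Continuous fun t : ℝ => g y + t * c).tendsto _).mono_left nhdsWithin_le_nhds
    refine le_of_tendsto hlim ?_
    filter_upwards [self_mem_nhdsWithin] with t ht using (hepi y t ht).le
  have hgc (y : F) : ((-c)⁻¹ • g) (y - y₀) * (-c) = g y - g y₀ := by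
    have : c ≠ 0 := hcneg.ne
    simp only [smul_apply, map_sub, smul_eq_mul]
    field_simp
    ring
  have hcpos : 0 < -c := by linarith
  refine ⟨(-c)⁻¹ • g, fun y => le_of_mul_le_mul_right ?_ hcpos, fun z hz =>
    le_of_mul_le_mul_right ?_ hcpos⟩
  · rw [hgc]
    have := hepi' y
    simp only at hu
    linarith
  · rw [sub_mul, hgc]
    have := hCu z hz
    have := hepi' y₀
    linarith

/-- The real epigraph of `Ω`, pushed forward by `x ↦ A x - y` and scaled by `α`, is convex. -/
theorem IsConvexFn.convex_image_epigraph {E F : Type*} [NormedAddCommGroup E] [NormedSpace ℝ E]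
    [NormedAddCommGroup F] [NormedSpace ℝ F] {Ω : E → EReal} (hΩ : IsConvexFn Ω)
    (A : E →L[ℝ] F) (y : F) (α : ℝ) :
    Convex ℝ {z : F × ℝ | ∃ x, ∃ w : ℝ, Ω x ≤ w ∧ z = (A x - y, α * w)} := by
  rintro _ ⟨x₁, w₁, h₁, rfl⟩ _ ⟨x₂, w₂, h₂, rfl⟩ a b ha hb hab
  refine ⟨a • x₁ + b • x₂, a * w₁ + b * w₂, (hΩ x₁ x₂ a b ha hb hab).trans ?_, ?_⟩
  · push_cast
    exact add_le_add (mul_le_mul_of_nonneg_left h₁ (EReal.coe_nonneg.2 ha))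
      (mul_le_mul_of_nonneg_left h₂ (EReal.coe_nonneg.2 hb))
  · ext
    · have : y = a • y + b • y := by rw [← add_smul, hab, one_smul]
      simp only [Prod.smul_mk, Prod.mk_add_mk, map_add, map_smul, smul_sub]
      nth_rw 3 [this]
      abel
    · simp only [Prod.smul_mk, Prod.mk_add_mk, smul_eq_mul]
      ring

/-- Lemma 1: `xs` minimizes the Tikhonov functional iff there is
`η ∈ Y*` with `⟨η, A xs − yδ⟩ = −‖η‖‖A xs − yδ‖`, `α‖η‖ = ‖A xs − yδ‖^(p−1)`
and `A*η ∈ ∂Ω(xs)`. -/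
theorem tikhonov_minimizer_iff (A : X →L[ℝ] Y) (yδ : Y) (p α : ℝ)
    (hp : 1 < p) (hα : 0 < α) (Ω : X → EReal)
    (hproper : IsProper Ω) (hconv : IsConvexFn Ω) (xs : X) :
    (∀ x, Tikhonov A yδ p α Ω xs ≤ Tikhonov A yδ p α Ω x) ↔
      ∃ η : Y →L[ℝ] ℝ, EtaCondition A yδ p α Ω xs η := by
  have hp0 : 0 < p := by linarith
  obtain ⟨hbot, x₀, hx₀⟩ := hproper
  have htik (x : X) (w : ℝ) (hw : Ω x = w) : Tikhonov A yδ p α Ω x =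
      ((1 / p * ‖A x - yδ‖ ^ p + α * w : ℝ) : EReal) := by
    simp [Tikhonov, hw]
  have hreal (x : X) (hx : Ω x ≠ ⊤) : ∃ w : ℝ, Ω x = w :=
    ⟨_, (EReal.coe_toReal hx (hbot x)).symm⟩
  have htop (x : X) (hx : Ω x = ⊤) : Tikhonov A yδ p α Ω x = ⊤ := by
    rw [Tikhonov, hx, EReal.coe_mul_top_of_pos hα, EReal.coe_add_top]
  constructor
  · intro hmin
    have hxs : Ω xs ≠ ⊤ := fun h => by
      obtain ⟨w, hw⟩ := hreal x₀ hx₀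
      have := hmin x₀
      rw [htop xs h, htik x₀ w hw, top_le_iff] at this
      exact EReal.coe_ne_top _ this
    obtain ⟨w₀, hw₀⟩ := hreal xs hxs
    obtain ⟨ζ, hζ, hζC⟩ := exists_subgradient_of_isMinOn (convexOn_norm_rpow_div hp)
      (continuous_const.mul (continuous_norm.rpow_const fun _ => Or.inr hp0.le))
      (hconv.convex_image_epigraph A yδ α) ⟨xs, w₀, hw₀.le, rfl⟩ (by
        rintro _ ⟨x, w, hw, rfl⟩
        obtain ⟨v, hv⟩ := hreal x fun h => by simp [h] at hw
        have h := hmin x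
        rw [htik xs w₀ hw₀, htik x v hv, EReal.coe_le_coe_iff] at h
        rw [hv, EReal.coe_le_coe_iff] at hw
        have := mul_le_mul_of_nonneg_left hw hα.le
        simp only
        linarith)
    obtain ⟨hnorm, happ⟩ := norm_eq_and_apply_eq_of_subgradient_norm_rpow hp hζ
    have hηn : ‖(-α⁻¹) • ζ‖ = α⁻¹ * ‖ζ‖ := by
      rw [norm_smul, norm_neg, Real.norm_of_nonneg (by positivity)]
    refine ⟨(-α⁻¹) • ζ, ?_, ?_, fun x => ?_⟩
    · rw [hηn, smul_apply, happ, smul_eq_mul]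
      ring
    · rw [hηn, mul_inv_cancel_left₀ hα.ne', hnorm]
    · rcases eq_or_ne (Ω x) ⊤ with hx | hx
      · rw [hx]
        exact le_top
      obtain ⟨w, hw⟩ := hreal x hx
      have h := hζC _ ⟨x, w, hw.le, rfl⟩
      rw [hw, hw₀, ← EReal.coe_add, EReal.coe_le_coe_iff]
      simp only [sub_sub_sub_cancel_right, ← map_sub] at h
      simp only [ContinuousLinearMap.comp_apply, smul_apply, smul_eq_mul]
      refine le_of_mul_le_mul_left (le_trans (le_of_eq ?_) h) hα
      field_simp
      ring
  · rintro ⟨η, h1, h2, h3⟩ x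
    rcases eq_or_ne (Ω x) ⊤ with hx | hx
    · rw [htop x hx]
      exact le_top
    have hxs : Ω xs ≠ ⊤ := fun h => by
      have := h3 x
      rw [h, EReal.top_add_coe, top_le_iff] at this
      exact hx this
    obtain ⟨w, hw⟩ := hreal x hx
    obtain ⟨w₀, hw₀⟩ := hreal xs hxs
    rw [htik xs w₀ hw₀, htik x w hw, EReal.coe_le_coe_iff]
    have h := h3 x
    rw [hw, hw₀, ← EReal.coe_add, EReal.coe_le_coe_iff, ContinuousLinearMap.comp_apply,
      map_sub, ← sub_sub_sub_cancel_right (A x) (A xs) yδ, map_sub, h1] at h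
    have ht := rpow_sub_one_mul_sub_le hp (norm_nonneg (A xs - yδ)) (norm_nonneg (A x - yδ))
    rw [← h2] at ht
    have hη : -(‖η‖ * ‖A x - yδ‖) ≤ η (A x - yδ) := (abs_le.1 (η.le_opNorm _)).1
    have := mul_le_mul_of_nonneg_left
      (by linarith : w₀ - ‖η‖ * (‖A x - yδ‖ - ‖A xs - yδ‖) ≤ w) hα.le
    linarith
end
end

section
/- Let x† satisfy A x† = y† with Ω(x†) < ∞, let δ ≥ 0 and ‖y^δ − y†‖ ≤ δ, and let x* be a minimizer of T_α^δ. If η ∈ Y* satisfies ⟨η, A x* − y^δ⟩ = −‖η‖·‖A x* − y^δ‖, α·‖η‖ = ‖A x* − y^δ‖^{p−1} and A*η ∈ ∂Ω(x*), then the Bregman distance satisfies B^Ω_{A*η}(x†, x*) ≤ Ω(x†) − Ω(x*) − (1/α)‖A x* − y^δ‖^p + (δ/α)‖A x* − y^δ‖^{p−1}. -/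
open Filter Topology Set

noncomputable section

variable {X Y : Type*} [NormedAddCommGroup X] [NormedSpace ℝ X] [CompleteSpace X]
  [NormedAddCommGroup Y] [NormedSpace ℝ Y] [CompleteSpace Y]

/-- the basic estimate for the skewed Bregman distance of a
Tikhonov minimizer. -/
theorem skewed_bregman_basic_estimate (A : X →L[ℝ] Y) (ydag : Y) (Ω : X → EReal)
    (hproper : IsProper Ω) (hconv : IsConvexFn Ω)
    (p α : ℝ) (hp : 1 < p) (hα : 0 < α)
    (xdag : X) (hsol : A xdag = ydag) (hfin : Ω xdag ≠ ⊤)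
    (δ : ℝ) (hδ : 0 ≤ δ) (yδ : Y) (hnoise : ‖yδ - ydag‖ ≤ δ)
    (xs : X) (hxs : ∀ x, Tikhonov A yδ p α Ω xs ≤ Tikhonov A yδ p α Ω x)
    (η : Y →L[ℝ] ℝ) (hη : EtaCondition A yδ p α Ω xs η) :
    Bregman Ω (η.comp A) xdag xs ≤
      Ω xdag - Ω xs - ((1 / α * ‖A xs - yδ‖ ^ p : ℝ) : EReal)
        + ((δ / α * ‖A xs - yδ‖ ^ (p - 1) : ℝ) : EReal) := by
  obtain ⟨hη_inner, hη_norm, -⟩ := hη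
  have hpow : ‖A xs - yδ‖ ^ p = ‖A xs - yδ‖ ^ (p - 1) * ‖A xs - yδ‖ := by
    rw [← Real.rpow_add_one' (norm_nonneg _) (by linarith), sub_add_cancel]
  have hresidual : 1 / α * ‖A xs - yδ‖ ^ p = ‖η‖ * ‖A xs - yδ‖ := by
    rw [hpow, ← hη_norm]
    field_simp
  have hnoise_term : δ / α * ‖A xs - yδ‖ ^ (p - 1) = ‖η‖ * δ := by
    rw [← hη_norm]
    field_simp
  have hsplit : (η.comp A) (xdag - xs) = -η (yδ - ydag) - η (A xs - yδ) := by
    simp only [ContinuousLinearMap.comp_apply, map_sub, hsol]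
    ring
  have hbound : η (yδ - ydag) ≤ ‖η‖ * δ :=
    (le_abs_self _).trans (η.le_opNorm_of_le hnoise)
  rw [hresidual, hnoise_term, Bregman, sub_eq_add_neg _ ((‖η‖ * ‖A xs - yδ‖ : ℝ) : EReal),
    add_assoc, sub_eq_add_neg _ (((η.comp A) (xdag - xs) : ℝ) : EReal)]
  refine add_le_add le_rfl ?_
  norm_cast
  linarith
end
end

section
/- Let x† be an Ω-minimizing solution of A x = y† and suppose the variational source condition 0 ≤ Ω(x) − Ω(x†) + φ(‖A x − A x†‖) holds for all x ∈ X, where φ is an index function such that t ↦ φ(t)/t is monotonically decreasing on (0,∞). Let c₂ > 0 and let δ > 0, ‖y^δ − y†‖ ≤ δ, and α ≤ c₂·δ^p/φ(δ). Then every minimizer x* of T_α^δ satisfies ‖A x* − y^δ‖ ≤ (2(1+p)c₂ + 1)^{1/(p−1)}·δ. -/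
open Filter Topology Set

noncomputable section

variable {X Y : Type*} [NormedAddCommGroup X] [NormedSpace ℝ X] [CompleteSpace X]
  [NormedAddCommGroup Y] [NormedSpace ℝ Y] [CompleteSpace Y]

/-- If `φ t / t` is decreasing on `(0, ∞)` and `0 < δ ≤ t`, then `φ t ≤ (t / δ) φ δ`. -/
theorem le_div_mul_of_antitoneOn_div {φ : ℝ → ℝ}
    (hdec : AntitoneOn (fun t => φ t / t) (Set.Ioi 0)) {δ t : ℝ} (hδ : 0 < δ) (hδt : δ ≤ t) :
    φ t ≤ t / δ * φ δ := by
  have ht : 0 < t := hδ.trans_le hδt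
  have h : φ t / t ≤ φ δ / δ := hdec (Set.mem_Ioi.2 hδ) (Set.mem_Ioi.2 ht) hδt
  rw [div_le_iff₀ ht] at h
  calc φ t ≤ φ δ / δ * t := h
    _ = t / δ * φ δ := by ring

/-- A number `s ≥ 1` with `s ^ p ≤ 1 + b * s` satisfies `s ≤ (b + 1) ^ (1 / (p - 1))`. -/
theorem le_rpow_of_rpow_le_one_add_mul {p s b : ℝ} (hp : 1 < p) (hs : 1 ≤ s)
    (h : s ^ p ≤ 1 + b * s) : s ≤ (b + 1) ^ (1 / (p - 1)) := by
  have hs0 : 0 < s := zero_lt_one.trans_le hs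
  have hpow : s ^ (p - 1) ≤ b + 1 := by
    rw [Real.rpow_sub_one hs0.ne', div_le_iff₀ hs0]
    linarith
  calc s = (s ^ (p - 1)) ^ (1 / (p - 1)) := by
        rw [← Real.rpow_mul hs0.le, mul_one_div_cancel (sub_pos.2 hp).ne', Real.rpow_one]
    _ ≤ (b + 1) ^ (1 / (p - 1)) :=
        Real.rpow_le_rpow (by positivity) hpow (one_div_nonneg.2 (sub_pos.2 hp).le)

/-- If `x` has Tikhonov value at most that of `z`, then a source condition between `x` and `z`
with defect `c` bounds the residual of `x`. -/
theorem tikhonov_residual_le {X Y : Type*} [NormedAddCommGroup X] [NormedSpace ℝ X]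
    [CompleteSpace X] [NormedAddCommGroup Y] [NormedSpace ℝ Y] [CompleteSpace Y]
    {A : X →L[ℝ] Y} {Ω : X → EReal} (hbot : ∀ x, Ω x ≠ ⊥) {p α c : ℝ} (hα : 0 < α)
    {yδ : Y} {x z : X} (hz : Ω z ≠ ⊤) (hsc : (0 : EReal) ≤ Ω x - Ω z + (c : EReal))
    (hxz : Tikhonov A yδ p α Ω x ≤ Tikhonov A yδ p α Ω z) :
    1 / p * ‖A x - yδ‖ ^ p ≤ 1 / p * ‖A z - yδ‖ ^ p + α * c := by
  unfold Tikhonov at hxz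
  lift Ω z to ℝ using ⟨hz, hbot z⟩ with b
  have hx : Ω x ≠ ⊤ := by
    intro hx
    rw [hx, EReal.coe_mul_top_of_pos hα, EReal.coe_add_top, top_le_iff] at hxz
    exact EReal.coe_ne_top (1 / p * ‖A z - yδ‖ ^ p + α * b) (by exact_mod_cast hxz)
  have hxbot := hbot x
  lift Ω x to ℝ using ⟨hx, hxbot⟩ with a
  norm_cast at hxz hsc
  nlinarith [mul_nonneg hα.le hsc]

/-- under the variational source condition and the a priori bound
`α ≤ c₂ δ^p / φ(δ)`, the residual of every Tikhonov minimizer satisfies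
`‖A xs − yδ‖ ≤ (2(1+p)c₂ + 1)^{1/(p−1)} δ`. -/
theorem residual_bound (A : X →L[ℝ] Y) (ydag : Y) (Ω : X → EReal)
    (hproper : IsProper Ω) (hconv : IsConvexFn Ω)
    (p : ℝ) (hp : 1 < p)
    (xdag : X) (hmin : IsOmegaMinSol A ydag Ω xdag)
    (φ : ℝ → ℝ) (hφ : IsIndexFun φ)
    (hdec : AntitoneOn (fun t => φ t / t) (Set.Ioi 0))
    (hvsc : ∀ x, (0 : EReal) ≤ Ω x - Ω xdag + ((φ ‖A x - A xdag‖ : ℝ) : EReal))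
    (c₂ : ℝ) (hc₂ : 0 < c₂)
    (δ : ℝ) (hδ : 0 < δ) (yδ : Y) (hnoise : ‖yδ - ydag‖ ≤ δ)
    (α : ℝ) (hα : 0 < α) (hαle : α ≤ c₂ * δ ^ p / φ δ)
    (xs : X) (hxs : ∀ x, Tikhonov A yδ p α Ω xs ≤ Tikhonov A yδ p α Ω x) :
    ‖A xs - yδ‖ ≤ (2 * (1 + p) * c₂ + 1) ^ (1 / (p - 1)) * δ := by
  obtain ⟨-, hmono, -, -, hnn⟩ := hφ
  obtain ⟨hAx, htop, -⟩ := hmin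
  have hp0 : 0 < p := zero_lt_one.trans hp
  have hφδ : 0 < φ δ := by
    refine lt_of_le_of_ne (hnn δ hδ.le) fun h => ?_
    rw [← h, div_zero] at hαle
    exact hα.not_ge hαle
  have hdag : ‖A xdag - yδ‖ ≤ δ := by rwa [hAx, norm_sub_rev]
  set r := ‖A xs - yδ‖ with hr
  rcases le_or_gt r δ with hrδ | hrδ
  · have h1 : 1 ≤ (2 * (1 + p) * c₂ + 1) ^ (1 / (p - 1)) :=
      Real.one_le_rpow (le_add_of_nonneg_left (by positivity))
        (one_div_nonneg.2 (sub_pos.2 hp).le)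
    exact hrδ.trans (le_mul_of_one_le_left hδ.le h1)
  have hdist : ‖A xs - A xdag‖ ≤ r + δ := by
    have h := norm_sub_le_norm_sub_add_norm_sub (A xs) yδ (A xdag)
    rw [norm_sub_rev yδ] at h
    linarith
  have hr0 : 0 < r := hδ.trans hrδ
  have hφr : φ ‖A xs - A xdag‖ ≤ (r + δ) / δ * φ δ :=
    (hmono (norm_nonneg _) (add_pos hr0 hδ).le hdist).trans
      (le_div_mul_of_antitoneOn_div hdec hδ (by linarith))
  have hbasic := tikhonov_residual_le hproper.1 hα htop (hvsc xs) (hxs xdag)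
  rw [← hr] at hbasic
  have hαφ : α * φ ‖A xs - A xdag‖ ≤ c₂ * δ ^ p * ((r + δ) / δ) :=
    calc α * φ ‖A xs - A xdag‖ ≤ α * ((r + δ) / δ * φ δ) :=
          mul_le_mul_of_nonneg_left hφr hα.le
      _ = α * φ δ * ((r + δ) / δ) := by ring
      _ ≤ c₂ * δ ^ p * ((r + δ) / δ) :=
          mul_le_mul_of_nonneg_right ((le_div_iff₀ hφδ).1 hαle) (by positivity)
  have hdagp : ‖A xdag - yδ‖ ^ p ≤ δ ^ p := Real.rpow_le_rpow (norm_nonneg _) hdag hp0.le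
  have hs1 : 1 ≤ r / δ := (one_le_div hδ).2 hrδ.le
  have hrp : r ^ p ≤ δ ^ p * (1 + p * c₂ * (r / δ + 1)) := by
    have h := mul_le_mul_of_nonneg_left (hbasic.trans (add_le_add_right hαφ _)) hp0.le
    have e : (r + δ) / δ = r / δ + 1 := by rw [add_div, div_self hδ.ne']
    rw [e, mul_add, ← mul_assoc, ← mul_assoc, mul_one_div_cancel hp0.ne', one_mul, one_mul] at h
    linarith
  have hsp : (r / δ) ^ p ≤ 1 + 2 * (1 + p) * c₂ * (r / δ) := by
    rw [Real.div_rpow hr0.le hδ.le, div_le_iff₀ (by positivity), mul_comm]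
    refine hrp.trans (mul_le_mul_of_nonneg_left ?_ (by positivity))
    have h1 : p * c₂ * (r / δ + 1) ≤ p * c₂ * (2 * (r / δ)) :=
      mul_le_mul_of_nonneg_left (by linarith) (by positivity)
    have h2 : 0 ≤ 2 * c₂ * (r / δ) := by positivity
    linarith
  exact (div_le_iff₀ hδ).1 (le_rpow_of_rpow_le_one_add_mul hp hs1 hsp)
end
end

section
/- Let x† be an Ω-minimizing solution of A x = y† and suppose the variational source condition 0 ≤ Ω(x) − Ω(x†) + φ(‖A x − A x†‖) holds for all x ∈ X, where φ is an index function such that t ↦ φ(t)/t is monotonically decreasing on (0,∞). Let c₁, c₂ > 0. Then there exists a constant C > 0 such that for all δ > 0, all data y^δ with ‖y^δ − y†‖ ≤ δ, all α with c₁·δ^p/φ(δ) ≤ α ≤ c₂·δ^p/φ(δ), every minimizer x* of T_α^δ, and every η ∈ Y* satisfying ⟨η, A x* − y^δ⟩ = −‖η‖·‖A x* − y^δ‖, α·‖η‖ = ‖A x* − y^δ‖^{p−1} and A*η ∈ ∂Ω(x*), the skewed Bregman distance satisfies B^Ω_{A*η}(x†, x*) ≤ C·φ(δ). -/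
open Filter Topology Set

noncomputable section

variable {X Y : Type*} [NormedAddCommGroup X] [NormedSpace ℝ X] [CompleteSpace X]
  [NormedAddCommGroup Y] [NormedSpace ℝ Y] [CompleteSpace Y]

/-- An index function is positive on `(0,∞)`. -/
lemma IsIndexFun.pos {φ : ℝ → ℝ} (hφ : IsIndexFun φ) {t : ℝ} (ht : 0 < t) : 0 < φ t := by
  obtain ⟨-, hmono, ⟨ε, hε, hstrict⟩, h0, -⟩ := hφ
  have hm : 0 < min t ε := lt_min ht hε
  have h1 : φ 0 < φ (min t ε) :=
    hstrict ⟨le_rfl, hε.le⟩ ⟨hm.le, min_le_right _ _⟩ hm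
  have h2 : φ (min t ε) ≤ φ t := hmono hm.le ht.le (min_le_left _ _)
  linarith

/-- If `φ t / t` is decreasing, then `φ` grows at most linearly. -/
lemma le_mul_of_antitoneOn_div {φ : ℝ → ℝ}
    (hdec : AntitoneOn (fun t => φ t / t) (Set.Ioi 0)) {s δ : ℝ} (hs : 0 ≤ s) (hδ : 0 < δ) :
    φ (s * δ + δ) ≤ φ δ * (s + 1) := by
  have hpos : 0 < s * δ + δ := by positivity
  have h : φ (s * δ + δ) / (s * δ + δ) ≤ φ δ / δ :=
    hdec (Set.mem_Ioi.2 hδ) (Set.mem_Ioi.2 hpos) (by nlinarith)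
  rw [div_le_iff₀ hpos] at h
  calc φ (s * δ + δ) ≤ φ δ / δ * (s * δ + δ) := h
    _ = φ δ * (s + 1) := by field_simp

/-- A superlinear power dominated by an affine function has bounded argument. -/
lemma le_rpow_of_rpow_le_affine {p c s : ℝ} (hp : 1 < p) (hc : 0 < c)
    (h : s ^ p ≤ 1 + c * (s + 1)) : s ≤ (1 + 2 * c) ^ (1 / (p - 1)) := by
  have hp1 : 0 < p - 1 := by linarith
  rcases le_total s 1 with h1 | h1
  · exact h1.trans (Real.one_le_rpow (by linarith) (by positivity))
  · have hs0 : 0 < s := by linarith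
    have h2 : s ^ (p - 1) ≤ 1 + 2 * c := by
      rw [Real.rpow_sub_one hs0.ne', div_le_iff₀ hs0]
      nlinarith
    calc s = (s ^ (p - 1)) ^ (1 / (p - 1)) := by
          rw [← Real.rpow_mul hs0.le, mul_one_div_cancel hp1.ne', Real.rpow_one]
      _ ≤ _ := by gcongr

/-- Theorem 1, convergence rate: under the variational source
condition and the a priori parameter choice `c₁ δ^p/φ(δ) ≤ α ≤ c₂ δ^p/φ(δ)`,
the skewed Bregman distance satisfies `B^Ω_{A*η}(x†, xs) ≤ C φ(δ)`. -/
theorem skewed_bregman_rate (A : X →L[ℝ] Y) (ydag : Y) (Ω : X → EReal)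
    (hproper : IsProper Ω) (hconv : IsConvexFn Ω)
    (p : ℝ) (hp : 1 < p)
    (xdag : X) (hmin : IsOmegaMinSol A ydag Ω xdag)
    (φ : ℝ → ℝ) (hφ : IsIndexFun φ)
    (hdec : AntitoneOn (fun t => φ t / t) (Set.Ioi 0))
    (hvsc : ∀ x, (0 : EReal) ≤ Ω x - Ω xdag + ((φ ‖A x - A xdag‖ : ℝ) : EReal))
    (c₁ c₂ : ℝ) (hc₁ : 0 < c₁) (hc₂ : 0 < c₂) :
    ∃ C : ℝ, 0 < C ∧
      ∀ δ : ℝ, 0 < δ → ∀ yδ : Y, ‖yδ - ydag‖ ≤ δ →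
        ∀ α : ℝ, c₁ * δ ^ p / φ δ ≤ α → α ≤ c₂ * δ ^ p / φ δ →
          ∀ xs : X, (∀ x, Tikhonov A yδ p α Ω xs ≤ Tikhonov A yδ p α Ω x) →
            ∀ η : Y →L[ℝ] ℝ, EtaCondition A yδ p α Ω xs η →
              Bregman Ω (η.comp A) xdag xs ≤ ((C * φ δ : ℝ) : EReal) := by
  set M : ℝ := 1 + 2 * (p * c₂) with hM
  have hp0 : 0 < p := by linarith
  have hp1 : 0 < p - 1 := by linarith
  have hM0 : 0 < M := by positivity
  set K : ℝ := M ^ (1 / (p - 1)) with hK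
  have hK0 : 0 < K := by positivity
  have hKM : K ^ (p - 1) = M := by
    rw [hK, ← Real.rpow_mul hM0.le, one_div_mul_cancel hp1.ne', Real.rpow_one]
  refine ⟨K + 1 + M / c₁, by positivity, ?_⟩
  intro δ hδ yδ hyδ α hα₁ hα₂ xs hxs η ⟨hη₁, hη₂, hη₃⟩
  have hφδ : 0 < φ δ := hφ.pos hδ
  have hδp : 0 < δ ^ p := Real.rpow_pos_of_pos hδ p
  have hα : 0 < α := lt_of_lt_of_le (by positivity) hα₁
  obtain ⟨hA, hfin, -⟩ := hmin
  have hxs_top : Ω xs ≠ ⊤ := by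
    intro htop
    have h := hη₃ xdag
    rw [htop, EReal.top_add_coe, top_le_iff] at h
    exact hfin h
  have hTik := hxs xdag
  have hV := hvsc xs
  unfold Bregman
  unfold Tikhonov at hTik
  obtain ⟨a, ha⟩ : ∃ a : ℝ, Ω xs = a := ⟨_, (EReal.coe_toReal hxs_top (hproper.1 xs)).symm⟩
  obtain ⟨b, hb⟩ : ∃ b : ℝ, Ω xdag = b := ⟨_, (EReal.coe_toReal hfin (hproper.1 xdag)).symm⟩
  rw [ha, hb] at hTik hV ⊢
  norm_cast at hTik hV ⊢
  rw [hA] at hTik hV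
  set r : ℝ := ‖A xs - yδ‖ with hr
  obtain ⟨s, hs⟩ : ∃ s, r = s * δ := ⟨r / δ, by field_simp⟩
  have hr0 : 0 ≤ r := norm_nonneg _
  have hs0 : 0 ≤ s := by
    by_contra! hneg
    nlinarith
  have hdist : ‖A xs - ydag‖ ≤ s * δ + δ := by
    calc ‖A xs - ydag‖ ≤ ‖A xs - yδ‖ + ‖yδ - ydag‖ := norm_sub_le_norm_sub_add_norm_sub _ _ _
      _ ≤ s * δ + δ := by linarith
  have hφs : φ ‖A xs - ydag‖ ≤ φ δ * (s + 1) :=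
    (hφ.2.1 (norm_nonneg _) ((norm_nonneg _).trans hdist) hdist).trans
      (le_mul_of_antitoneOn_div hdec hs0 hδ)
  have hgap : b - a ≤ φ δ * (s + 1) := by linarith
  have hres : ‖ydag - yδ‖ ^ p ≤ δ ^ p := by
    rw [norm_sub_rev]
    gcongr
  have hαφ : α * φ δ ≤ c₂ * δ ^ p := (le_div_iff₀ hφδ).1 hα₂
  have hrp : r ^ p = s ^ p * δ ^ p := by rw [hs, Real.mul_rpow hs0 hδ.le]
  have hsK : s ≤ K := by
    refine le_rpow_of_rpow_le_affine hp (mul_pos hp0 hc₂) ?_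
    have h1 : r ^ p ≤ ‖ydag - yδ‖ ^ p + p * (α * (b - a)) := by
      have h2 := mul_le_mul_of_nonneg_left hTik hp0.le
      have h3 : ∀ u v : ℝ, p * (1 / p * u + v) = u + p * v := by
        intro u v
        field_simp
      rw [h3, h3] at h2
      linarith
    have h4 : α * (b - a) ≤ c₂ * δ ^ p * (s + 1) := by
      calc α * (b - a) ≤ α * (φ δ * (s + 1)) := by gcongr
        _ = α * φ δ * (s + 1) := by ring
        _ ≤ c₂ * δ ^ p * (s + 1) := by gcongr
    have h5 : p * (α * (b - a)) ≤ p * (c₂ * δ ^ p * (s + 1)) := by gcongr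
    refine le_of_mul_le_mul_right ?_ hδp
    rw [← hrp]
    linarith
  have hηδ : ‖η‖ * δ ≤ M / c₁ * φ δ := by
    have h1 : r ^ (p - 1) ≤ M * δ ^ (p - 1) := by
      rw [← hKM, ← Real.mul_rpow hK0.le hδ.le, hs]
      gcongr
    have h2 : α * (‖η‖ * δ) ≤ M * δ ^ p := by
      calc α * (‖η‖ * δ) = r ^ (p - 1) * δ := by rw [← hη₂]; ring
        _ ≤ M * δ ^ (p - 1) * δ := by gcongr
        _ = M * δ ^ p := by rw [mul_assoc, Real.rpow_sub_one hδ.ne', div_mul_cancel₀ _ hδ.ne']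
    have h3 : c₁ * δ ^ p ≤ α * φ δ := (div_le_iff₀ hφδ).1 hα₁
    refine le_of_mul_le_mul_left (h2.trans ?_) hα
    calc M * δ ^ p = M / c₁ * (c₁ * δ ^ p) := by field_simp
      _ ≤ M / c₁ * (α * φ δ) := by gcongr
      _ = α * (M / c₁ * φ δ) := by ring
  have hpair : -(‖η‖ * δ) ≤ η (A (xdag - xs)) := by
    have h1 : η (A (xdag - xs)) = -η (yδ - ydag) - η (A xs - yδ) := by
      simp only [map_sub, hA]
      ring
    have h2 : η (yδ - ydag) ≤ ‖η‖ * δ :=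
      (le_abs_self _).trans ((η.le_opNorm _).trans (by gcongr))
    have h3 : 0 ≤ ‖η‖ * r := by positivity
    rw [h1, hη₁]
    linarith
  have hKs : φ δ * (s + 1) ≤ φ δ * (K + 1) := by gcongr
  rw [ContinuousLinearMap.comp_apply]
  linarith
end
end

section
/- Assume the equation A x = y† has a solution with finite Ω, that Ω is proper and convex, that for every c ∈ ℝ the sublevel set {x ∈ X : Ω(x) ≤ c} is weakly sequentially closed, and that every sequence in such a sublevel set has a weakly convergent subsequence. Let x† be an Ω-minimizing solution of A x = y† and let D(r) = sup_{x∈X} (Ω(x†) − Ω(x) − r·‖A x − A x†‖). Then lim_{r→∞} D(r) = 0. -/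
open Filter Topology Set

noncomputable section

variable {X Y : Type*} [NormedAddCommGroup X] [NormedSpace ℝ X] [CompleteSpace X]
  [NormedAddCommGroup Y] [NormedSpace ℝ Y] [CompleteSpace Y]

/-- If every sequence in a sublevel set of `Ω` has a weakly convergent subsequence and sublevel sets
are weakly sequentially closed, a functional without the value `⊥` is bounded below. -/
theorem exists_real_lower_bound {X : Type*} [NormedAddCommGroup X] [NormedSpace ℝ X]
    (Ω : X → EReal) (hbot : ∀ x, Ω x ≠ ⊥)
    (hclosed : ∀ c : ℝ, ∀ u : ℕ → X, (∀ n, Ω (u n) ≤ (c : EReal)) →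
      ∀ x : X, (∀ f : X →L[ℝ] ℝ, Tendsto (fun n => f (u n)) atTop (𝓝 (f x))) →
        Ω x ≤ (c : EReal))
    (hcompact : ∀ c : ℝ, ∀ u : ℕ → X, (∀ n, Ω (u n) ≤ (c : EReal)) →
      ∃ x : X, ∃ σ : ℕ → ℕ, StrictMono σ ∧
        ∀ f : X →L[ℝ] ℝ, Tendsto (fun n => f (u (σ n))) atTop (𝓝 (f x))) :
    ∃ m : ℝ, ∀ x, (m : EReal) ≤ Ω x := by
  by_contra! h
  choose u hu using fun n : ℕ => h (-(n : ℝ))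
  have hle : ∀ c : ℝ, ∀ n : ℕ, -c ≤ n → Ω (u n) ≤ (c : EReal) := fun c n hn =>
    (hu n).le.trans (EReal.coe_le_coe_iff.2 (by linarith))
  obtain ⟨x, σ, hσ, hx⟩ := hcompact 0 u fun n => hle 0 n (by simp)
  refine hbot x ((EReal.eq_bot_iff_forall_lt _).2 fun y => ?_)
  obtain ⟨N, hN⟩ := exists_nat_ge (-(y - 1))
  refine (hclosed (y - 1) (fun n => u (σ (n + N))) (fun n => hle _ _ ?_) x
    fun f => (hx f).comp (tendsto_add_atTop_nat N)).trans_lt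
      (EReal.coe_lt_coe_iff.2 (by linarith))
  have h₁ : N ≤ σ (n + N) := (Nat.le_add_left N n).trans (hσ.id_le _)
  exact hN.trans (by exact_mod_cast h₁)

/-- under the standing assumptions (existence of a solution with
finite `Ω`, `Ω` proper and convex, sublevel sets of `Ω` weakly sequentially
closed and weakly sequentially compact), the distance function tends to `0`
as `r → ∞`.  Weak convergence of a sequence `u` to `x` is expressed by
`⟨f, u n⟩ → ⟨f, x⟩` for every `f ∈ X*`. -/
theorem distance_function_tendsto_zero (A : X →L[ℝ] Y) (ydag : Y) (Ω : X → EReal)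
    (hex : ∃ x, A x = ydag ∧ Ω x ≠ ⊤)
    (hproper : IsProper Ω) (hconv : IsConvexFn Ω)
    (hclosed : ∀ c : ℝ, ∀ u : ℕ → X, (∀ n, Ω (u n) ≤ (c : EReal)) →
      ∀ x : X, (∀ f : X →L[ℝ] ℝ, Tendsto (fun n => f (u n)) atTop (𝓝 (f x))) →
        Ω x ≤ (c : EReal))
    (hcompact : ∀ c : ℝ, ∀ u : ℕ → X, (∀ n, Ω (u n) ≤ (c : EReal)) →
      ∃ x : X, ∃ σ : ℕ → ℕ, StrictMono σ ∧
        ∀ f : X →L[ℝ] ℝ, Tendsto (fun n => f (u (σ n))) atTop (𝓝 (f x)))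
    (xdag : X) (hmin : IsOmegaMinSol A ydag Ω xdag) :
    Tendsto (fun r : ℝ => distFun A Ω xdag r) atTop (𝓝 (0 : EReal)) := by
  obtain ⟨hA, htop, hle⟩ := hmin
  obtain ⟨m, hm⟩ := exists_real_lower_bound Ω hproper.1 hclosed hcompact
  obtain ⟨w, hw⟩ : ∃ w : ℝ, Ω xdag = w :=
    ⟨_, (EReal.coe_toReal htop (hproper.1 xdag)).symm⟩
  refine tendsto_order.2 ⟨fun a ha => Eventually.of_forall fun r => ha.trans_le ?_, fun a ha => ?_⟩
  · refine le_iSup_of_le xdag ?_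
    rw [hw, ← EReal.coe_sub, ← EReal.coe_sub]
    simp
  obtain ⟨ε, hε, hεa⟩ := EReal.lt_iff_exists_real_btwn.1 ha
  have hε' : 0 < ε := by exact_mod_cast hε
  suffices h : ∃ n : ℕ, ∀ x, ∀ v : ℝ, Ω x = v → w - v - n * ‖A x - A xdag‖ ≤ ε by
    obtain ⟨n, hn⟩ := h
    filter_upwards [eventually_ge_atTop (n : ℝ)] with r hr
    refine (iSup_le fun x => ?_).trans_lt hεa
    by_cases hx : Ω x = ⊤
    · simp [hx, hw]
    · have hv := (EReal.coe_toReal hx (hproper.1 x)).symm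
      rw [hw, hv, ← EReal.coe_sub, ← EReal.coe_sub, EReal.coe_le_coe_iff]
      have := hn x _ hv
      have := mul_le_mul_of_nonneg_right hr (norm_nonneg (A x - A xdag))
      linarith
  by_contra! h
  choose u v hv hu using h
  have hvm : ∀ n, m ≤ v n := fun n => by exact_mod_cast (hv n) ▸ hm (u n)
  have hsub : ∀ n, Ω (u n) ≤ ((w - ε : ℝ) : EReal) := fun n => by
    rw [hv n, EReal.coe_le_coe_iff]
    have : 0 ≤ (n : ℝ) * ‖A (u n) - A xdag‖ := by positivity
    linarith [hu n]
  have hAu : Tendsto (fun n => A (u n)) atTop (𝓝 (A xdag)) := by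
    rw [tendsto_iff_norm_sub_tendsto_zero]
    refine squeeze_zero' (Eventually.of_forall fun n => norm_nonneg _) ?_
      (tendsto_const_div_atTop_nhds_zero_nat (w - m))
    filter_upwards [eventually_gt_atTop 0] with n hn
    rw [le_div_iff₀' (by exact_mod_cast hn)]
    linarith [hu n, hvm n]
  obtain ⟨x, σ, hσ, hx⟩ := hcompact _ u hsub
  have hAx : A x = A xdag := by
    refine (SeparatingDual.eq_iff_forall_dual_eq (R := ℝ)).2 fun g => ?_
    exact tendsto_nhds_unique (hx (g.comp A))
      ((g.continuous.tendsto _).comp (hAu.comp hσ.tendsto_atTop))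
  have hlt := (hle x (hAx.trans hA)).trans
    (hclosed _ (fun n => u (σ n)) (fun n => hsub _) x hx)
  rw [hw, EReal.coe_le_coe_iff] at hlt
  linarith
end
end

section
/- Let x† be an Ω-minimizing solution of A x = y†, assume the function D(r) = sup_{x∈X} (Ω(x†) − Ω(x) − r·‖A x − A x†‖) is finite-valued with D(r) > 0 for all r ≥ 0, and assume lim_{r→∞} D(r) = 0. Then the function Φ : (0,∞) → (0,∞) defined by Φ(r) = D(r)/r is a strictly decreasing continuous bijection from (0,∞) onto (0,∞); in particular it has a well-defined inverse Φ^{-1} : (0,∞) → (0,∞). -/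
open Filter Topology Set

noncomputable section

variable {X Y : Type*} [NormedAddCommGroup X] [NormedSpace ℝ X] [CompleteSpace X]
  [NormedAddCommGroup Y] [NormedSpace ℝ Y] [CompleteSpace Y]

theorem distFun_le_coe_iff (A : X →L[ℝ] Y) (Ω : X → EReal) (hproper : IsProper Ω)
    (xdag : X) (hfin : Ω xdag ≠ ⊤) (r c : ℝ) :
    distFun A Ω xdag r ≤ (c : EReal) ↔
      ∀ x, Ω x ≠ ⊤ → (Ω xdag).toReal - (Ω x).toReal - r * ‖A x - A xdag‖ ≤ c := by
  unfold distFun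
  rw [iSup_le_iff]
  refine forall_congr' fun x => ?_
  have hdag := EReal.coe_toReal hfin (hproper.1 xdag)
  by_cases hx : Ω x = ⊤
  · rw [hx, ← hdag]
    simp
  · have hx' := EReal.coe_toReal hx (hproper.1 x)
    rw [← hdag, ← hx', ← EReal.coe_sub, ← EReal.coe_sub, EReal.coe_le_coe_iff]
    simp

/-- The quotient `r ↦ D r / r` is strictly decreasing for `D` positive and decreasing. -/
theorem strictAntiOn_div_self {D : ℝ → ℝ} (hanti : AntitoneOn D (Ioi 0))
    (hpos : ∀ r, 0 < r → 0 < D r) : StrictAntiOn (fun r => D r / r) (Ioi 0) := by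
  intro r hr s hs hrs
  exact div_lt_div₀' (hanti hr hs hrs.le) hrs (hpos r hr) hr

theorem surjOn_div_self {D : ℝ → ℝ} (hanti : AntitoneOn D (Ioi 0))
    (hpos : ∀ r, 0 < r → 0 < D r) (hcont : ContinuousOn D (Ioi 0)) :
    SurjOn (fun r => D r / r) (Ioi 0) (Ioi 0) := by
  intro y (hy : 0 < y)
  have h1 : (0 : ℝ) < 1 := one_pos
  have hq : 0 < D 1 / y := div_pos (hpos 1 h1) hy
  have ha : 0 < min 1 (D 1 / y) := lt_min h1 hq
  have hb : 0 < max 1 (D 1 / y) := lt_max_of_lt_left h1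
  have hab : min 1 (D 1 / y) ≤ max 1 (D 1 / y) := min_le_max
  have hsub : Icc (min 1 (D 1 / y)) (max 1 (D 1 / y)) ⊆ Ioi 0 :=
    fun z hz => ha.trans_le hz.1
  have hc : ContinuousOn (fun r => D r / r) (Ioi 0) :=
    hcont.div continuousOn_id fun z hz => ne_of_gt hz
  obtain ⟨z, hz, hzy⟩ := intermediate_value_Icc' hab (hc.mono hsub) (show y ∈ Icc _ _ from by
    constructor
    · rw [div_le_iff₀ hb]
      calc D (max 1 (D 1 / y)) ≤ D 1 := hanti h1 hb (le_max_left _ _)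
        _ = y * (D 1 / y) := by field_simp
        _ ≤ y * max 1 (D 1 / y) := by gcongr; exact le_max_right _ _
    · rw [le_div_iff₀ ha]
      calc y * min 1 (D 1 / y) ≤ y * (D 1 / y) := by gcongr; exact min_le_right _ _
        _ = D 1 := by field_simp
        _ ≤ D (min 1 (D 1 / y)) := hanti ha h1 (min_le_left _ _))
  exact ⟨z, hsub hz, hzy⟩

/-- if `D` is finite-valued and positive on `[0,∞)` with
`D(r) → 0` as `r → ∞`, then `Φ(r) = D(r)/r` is a strictly decreasing
continuous bijection from `(0,∞)` onto `(0,∞)`; in particular it has a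
well-defined inverse `Φ⁻¹ : (0,∞) → (0,∞)`. -/
theorem Phi_strictAnti_bijection (A : X →L[ℝ] Y) (ydag : Y) (Ω : X → EReal)
    (hproper : IsProper Ω) (hconv : IsConvexFn Ω)
    (xdag : X) (hmin : IsOmegaMinSol A ydag Ω xdag)
    (D : ℝ → ℝ) (hD : ∀ r, 0 ≤ r → (D r : EReal) = distFun A Ω xdag r)
    (hpos : ∀ r, 0 ≤ r → 0 < D r)
    (hlim : Tendsto D atTop (𝓝 0)) :
    StrictAntiOn (fun r => D r / r) (Set.Ioi 0) ∧
      ContinuousOn (fun r => D r / r) (Set.Ioi 0) ∧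
      Set.BijOn (fun r => D r / r) (Set.Ioi 0) (Set.Ioi 0) := by
  have hle (r : ℝ) (hr : 0 ≤ r) (c : ℝ) := by
    simpa only [← hD r hr, EReal.coe_le_coe_iff] using
      distFun_le_coe_iff A Ω hproper xdag hmin.2.1 r c
  have hbound (r : ℝ) (hr : 0 ≤ r) := (hle r hr (D r)).1 le_rfl
  have hanti : AntitoneOn D (Ioi 0) := by
    intro r hr s hs hrs
    refine (hle s (le_of_lt hs) _).2 fun x hx => le_trans ?_ (hbound r (le_of_lt hr) x hx)
    gcongr
  have hconvD : ConvexOn ℝ (Ioi 0) D := by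
    refine ⟨convex_Ioi 0, fun r hr s hs a b ha hb hab => ?_⟩
    have hmem : a • r + b • s ∈ Ioi (0 : ℝ) := convex_Ioi 0 hr hs ha hb hab
    refine (hle _ (le_of_lt hmem) _).2 fun x hx => ?_
    have hr' := mul_le_mul_of_nonneg_left (hbound r (le_of_lt hr) x hx) ha
    have hs' := mul_le_mul_of_nonneg_left (hbound s (le_of_lt hs) x hx) hb
    obtain rfl : b = 1 - a := by linarith
    simp only [smul_eq_mul]
    linarith
  have hcont : ContinuousOn D (Ioi 0) := hconvD.continuousOn isOpen_Ioi
  have hpos' : ∀ r, 0 < r → 0 < D r := fun r hr => hpos r hr.le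
  have hstrict := strictAntiOn_div_self hanti hpos'
  exact ⟨hstrict, hcont.div continuousOn_id fun z hz => ne_of_gt hz,
    fun r hr => div_pos (hpos' r hr) hr, hstrict.injOn, surjOn_div_self hanti hpos' hcont⟩
end
end

section
/- Let x† be an Ω-minimizing solution of A x = y†, assume D(r) = sup_{x∈X} (Ω(x†) − Ω(x) − r·‖A x − A x†‖) is finite-valued with D(r) > 0 for all r ≥ 0 and lim_{r→∞} D(r) = 0, and let Φ(r) = D(r)/r with inverse Φ^{-1} : (0,∞) → (0,∞). Define φ : [0,∞) → [0,∞) by φ(t) = 2·D(Φ^{-1}(t)) for t > 0 and φ(0) = 0. Then: (a) the variational source condition 0 ≤ Ω(x) − Ω(x†) + φ(‖A x − A x†‖) holds for all x ∈ X; (b) φ is an index function; and (c) the function t ↦ φ(t)/t is monotonically decreasing on (0,∞). -/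
open Filter Topology Set

noncomputable section

variable {X Y : Type*} [NormedAddCommGroup X] [NormedSpace ℝ X] [CompleteSpace X]
  [NormedAddCommGroup Y] [NormedSpace ℝ Y] [CompleteSpace Y]

omit [CompleteSpace X] [CompleteSpace Y] in
/-- Upper bounds of a finite `distFun A Ω xdag r` are tested on the effective domain of `Ω`. -/
lemma le_iff_of_eq_distFun {A : X →L[ℝ] Y} {Ω : X → EReal} (hbot : ∀ x, Ω x ≠ ⊥)
    {xdag : X} (htop : Ω xdag ≠ ⊤) {r d : ℝ} (hd : (d : EReal) = distFun A Ω xdag r) (c : ℝ) :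
    d ≤ c ↔ ∀ x, Ω x ≠ ⊤ →
      (Ω xdag).toReal - (Ω x).toReal - r * ‖A x - A xdag‖ ≤ c := by
  rw [← EReal.coe_le_coe_iff, hd, distFun, iSup_le_iff]
  refine forall_congr' fun x => ?_
  rw [← EReal.coe_toReal htop (hbot xdag)]
  by_cases hx : Ω x = ⊤
  · simp [hx]
  · rw [← EReal.coe_toReal hx (hbot x), ← EReal.coe_sub, ← EReal.coe_sub,
      EReal.coe_le_coe_iff]
    simp

omit [CompleteSpace X] [CompleteSpace Y] in
lemma antitoneOn_of_eq_distFun {A : X →L[ℝ] Y} {Ω : X → EReal} (hbot : ∀ x, Ω x ≠ ⊥)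
    {xdag : X} (htop : Ω xdag ≠ ⊤) {D : ℝ → ℝ}
    (hD : ∀ r, 0 ≤ r → (D r : EReal) = distFun A Ω xdag r) : AntitoneOn D (Ici 0) := by
  intro r hr s hs hrs
  refine (le_iff_of_eq_distFun hbot htop (hD s hs) _).2 fun x hx => ?_
  have h := (le_iff_of_eq_distFun hbot htop (hD r hr) _).1 le_rfl x hx
  have := mul_le_mul_of_nonneg_right hrs (norm_nonneg (A x - A xdag))
  linarith

omit [CompleteSpace X] [CompleteSpace Y] in
lemma convexOn_of_eq_distFun {A : X →L[ℝ] Y} {Ω : X → EReal} (hbot : ∀ x, Ω x ≠ ⊥)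
    {xdag : X} (htop : Ω xdag ≠ ⊤) {D : ℝ → ℝ}
    (hD : ∀ r, 0 ≤ r → (D r : EReal) = distFun A Ω xdag r) : ConvexOn ℝ (Ici 0) D := by
  refine ⟨convex_Ici 0, fun r hr s hs a b ha hb hab => ?_⟩
  refine (le_iff_of_eq_distFun hbot htop (hD _ (convex_Ici 0 hr hs ha hb hab)) _).2
    fun x hx => ?_
  have h₁ := mul_le_mul_of_nonneg_left
    ((le_iff_of_eq_distFun hbot htop (hD r hr) _).1 le_rfl x hx) ha
  have h₂ := mul_le_mul_of_nonneg_left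
    ((le_iff_of_eq_distFun hbot htop (hD s hs) _).1 le_rfl x hx) hb
  obtain rfl : b = 1 - a := by linarith
  simp only [smul_eq_mul]
  linarith

/-- A positive convex function on `[0, ∞)` vanishing at infinity is strictly decreasing. -/
lemma ConvexOn.strictAntiOn_of_tendsto_zero {D : ℝ → ℝ} (hconv : ConvexOn ℝ (Ici 0) D)
    (hpos : ∀ r, 0 ≤ r → 0 < D r) (hlim : Tendsto D atTop (𝓝 0)) :
    StrictAntiOn D (Ici 0) := by
  intro r hr s hs hrs
  by_contra! hle
  refine (hpos s hs).not_ge (ge_of_tendsto hlim ?_)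
  filter_upwards [eventually_gt_atTop s] with u hu
  have hslope := hconv.slope_mono_adjacent hr (mem_Ici.2 (le_trans hs hu.le)) hrs hu
  have h₀ : 0 ≤ (D s - D r) / (s - r) := div_nonneg (by linarith) (by linarith)
  have h₁ := (le_div_iff₀ (sub_pos.2 hu)).1 (h₀.trans hslope)
  linarith

/-- A monotone function `φ` with `φ t / t` antitone is continuous on `(0, ∞)`. -/
lemma continuousAt_of_monotoneOn_of_antitoneOn_div {φ : ℝ → ℝ} (hmono : MonotoneOn φ (Ioi 0))
    (hanti : AntitoneOn (fun t => φ t / t) (Ioi 0)) {t : ℝ} (ht : 0 < t) :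
    ContinuousAt φ t := by
  have hne := ht.ne'
  have hlow : Tendsto (fun s => min (φ t) (φ t / t * s)) (𝓝 t) (𝓝 (φ t)) := by
    have : ContinuousAt (fun s => min (φ t) (φ t / t * s)) t := by fun_prop
    simpa [ContinuousAt, hne] using this
  have hupp : Tendsto (fun s => max (φ t) (φ t / t * s)) (𝓝 t) (𝓝 (φ t)) := by
    have : ContinuousAt (fun s => max (φ t) (φ t / t * s)) t := by fun_prop
    simpa [ContinuousAt, hne] using this
  refine tendsto_of_tendsto_of_tendsto_of_le_of_le' hlow hupp ?_ ?_
  · filter_upwards [lt_mem_nhds ht] with s hs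
    rcases le_total s t with hst | hst
    · exact (min_le_right _ _).trans ((le_div_iff₀ hs).1 (hanti hs ht hst))
    · exact (min_le_left _ _).trans (hmono ht hs hst)
  · filter_upwards [lt_mem_nhds ht] with s hs
    rcases le_total s t with hst | hst
    · exact (hmono hs ht hst).trans (le_max_left _ _)
    · exact ((div_le_iff₀ hs).1 (hanti ht hs hst)).trans (le_max_right _ _)

lemma lt_of_div_lt_div_of_antitoneOn {D : ℝ → ℝ} (hanti : AntitoneOn D (Ici 0))
    (hpos : ∀ r, 0 ≤ r → 0 < D r) {r s : ℝ} (hr : 0 < r) (hs : 0 < s)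
    (h : D r / r < D s / s) : s < r := by
  by_contra! hrs
  exact h.not_ge
    (div_le_div₀ (hpos r hr.le).le (hanti (mem_Ici.2 hr.le) (mem_Ici.2 hs.le) hrs) hr hrs)

/-- Lemma 2: with `φ(t) = 2 D(Φ⁻¹(t))` for `t > 0` and `φ(0) = 0`,
the variational source condition holds, `φ` is an index function and
`t ↦ φ(t)/t` is monotonically decreasing on `(0,∞)`. -/
theorem vsc_from_distFun (A : X →L[ℝ] Y) (ydag : Y) (Ω : X → EReal)
    (hproper : IsProper Ω) (hconv : IsConvexFn Ω)
    (xdag : X) (hmin : IsOmegaMinSol A ydag Ω xdag)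
    (D : ℝ → ℝ) (hD : ∀ r, 0 ≤ r → (D r : EReal) = distFun A Ω xdag r)
    (hpos : ∀ r, 0 ≤ r → 0 < D r)
    (hlim : Tendsto D atTop (𝓝 0))
    (Φinv : ℝ → ℝ) (hΦinv : ∀ t, 0 < t → 0 < Φinv t ∧ D (Φinv t) / Φinv t = t)
    (φ : ℝ → ℝ) (hφdef : ∀ t, 0 < t → φ t = 2 * D (Φinv t)) (hφ0 : φ 0 = 0) :
    (∀ x, (0 : EReal) ≤ Ω x - Ω xdag + ((φ ‖A x - A xdag‖ : ℝ) : EReal)) ∧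
      IsIndexFun φ ∧ AntitoneOn (fun t => φ t / t) (Set.Ioi 0) := by
  have hbot := hproper.1
  obtain ⟨hAx, htop, hminle⟩ := hmin
  have hstrict := (convexOn_of_eq_distFun hbot htop hD).strictAntiOn_of_tendsto_zero hpos hlim
  have hDanti := antitoneOn_of_eq_distFun hbot htop hD
  have hΦpos : ∀ t, 0 < t → 0 < Φinv t := fun t ht => (hΦinv t ht).1
  have hΦeq : ∀ t, 0 < t → D (Φinv t) = t * Φinv t := fun t ht =>
    (div_eq_iff (hΦpos t ht).ne').1 (hΦinv t ht).2
  have hΦanti : StrictAntiOn Φinv (Ioi 0) := fun s hs t ht hst =>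
    lt_of_div_lt_div_of_antitoneOn hDanti hpos (hΦpos s hs) (hΦpos t ht)
      (by rwa [(hΦinv s hs).2, (hΦinv t ht).2])
  have hφpos : ∀ t, 0 < t → 0 < φ t := fun t ht => by
    rw [hφdef t ht]
    exact mul_pos two_pos (hpos _ (hΦpos t ht).le)
  have hφstrict : StrictMonoOn φ (Ici 0) := by
    intro s hs t _ hst
    have ht : 0 < t := lt_of_le_of_lt hs hst
    rcases (mem_Ici.1 hs).eq_or_lt with rfl | hs
    · rw [hφ0]
      exact hφpos t ht
    · rw [hφdef s hs, hφdef t ht]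
      have := hstrict (mem_Ici.2 (hΦpos t ht).le) (mem_Ici.2 (hΦpos s hs).le)
        (hΦanti hs ht hst)
      linarith
  have hφdiv : AntitoneOn (fun t => φ t / t) (Ioi 0) := by
    have h : ∀ t ∈ Ioi (0 : ℝ), φ t / t = 2 * Φinv t := fun t ht => by
      rw [hφdef t ht, hΦeq t ht, div_eq_iff (ne_of_gt ht)]
      ring
    intro s hs t ht hst
    simp only [h s hs, h t ht]
    linarith [hΦanti.antitoneOn hs ht hst]
  refine ⟨fun x => ?_, ⟨?_, hφstrict.monotoneOn,
    ⟨1, one_pos, hφstrict.mono Icc_subset_Ici_self⟩, hφ0, fun t ht => ?_⟩, hφdiv⟩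
  · by_cases hx : Ω x = ⊤
    · rw [hx, ← EReal.coe_toReal htop (hbot xdag)]
      simp
    have hle : (Ω xdag).toReal ≤ (Ω x).toReal + φ ‖A x - A xdag‖ := by
      rcases (norm_nonneg (A x - A xdag)).eq_or_lt with h0 | ht
      · rw [← h0, hφ0, add_zero]
        refine EReal.toReal_le_toReal (hminle x ?_) (hbot xdag) hx
        rw [← hAx]
        exact sub_eq_zero.1 (norm_eq_zero.1 h0.symm)
      · have h := (le_iff_of_eq_distFun hbot htop (hD _ (hΦpos _ ht).le) _).1 le_rfl x hx
        rw [hφdef _ ht]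
        linarith [hΦeq _ ht]
    rw [← EReal.coe_toReal htop (hbot xdag), ← EReal.coe_toReal hx (hbot x),
      ← EReal.coe_sub, ← EReal.coe_add]
    exact EReal.coe_nonneg.2 (by linarith)
  · intro t ht
    rcases (mem_Ici.1 ht).eq_or_lt with rfl | ht
    · rw [Metric.continuousWithinAt_iff]
      intro ε hε
      obtain ⟨R, hRD, hR⟩ := ((hlim.eventually_lt_const (half_pos hε)).and
        (eventually_gt_atTop 0)).exists
      refine ⟨D R / R, div_pos (hpos R hR.le) hR, fun {t} ht hdist => ?_⟩
      rcases (mem_Ici.1 ht).eq_or_lt with rfl | ht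
      · simpa using hε
      rw [Real.dist_eq, sub_zero, abs_of_pos ht] at hdist
      rw [Real.dist_eq, hφ0, sub_zero, abs_of_pos (hφpos t ht), hφdef t ht]
      have hlt : R < Φinv t := lt_of_div_lt_div_of_antitoneOn hDanti hpos (hΦpos t ht) hR
        (by rwa [(hΦinv t ht).2])
      linarith [hDanti (mem_Ici.2 hR.le) (mem_Ici.2 (hΦpos t ht).le) hlt.le]
    · exact (continuousAt_of_monotoneOn_of_antitoneOn_div
        (hφstrict.monotoneOn.mono Ioi_subset_Ici_self) hφdiv ht).continuousWithinAt
  · rcases ht.eq_or_lt with rfl | ht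
    · exact hφ0.ge
    · exact (hφpos t ht).le
end
end

section
/- Let x† be an Ω-minimizing solution of A x = y† and let D(r) = sup_{x∈X} (Ω(x†) − Ω(x) − r·‖A x − A x†‖). Let x̄ ∈ X and η ∈ Y* be such that A*η ∈ ∂Ω(x̄). Then D(‖η‖) ≤ B^Ω_{A*η}(x†, x̄), i.e. D(‖η‖) ≤ Ω(x†) − Ω(x̄) − ⟨A*η, x† − x̄⟩; moreover the supremum defining sup_{x∈X} (Ω(x†) − Ω(x) + ⟨η, A x − A x†⟩) is attained at x = x̄. -/
open Filter Topology Set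

noncomputable section

variable {X Y : Type*} [NormedAddCommGroup X] [NormedSpace ℝ X] [CompleteSpace X]
  [NormedAddCommGroup Y] [NormedSpace ℝ Y] [CompleteSpace Y]

/-- A proper functional is finite at any point where it has a subgradient. -/
theorem IsSubgradient.exists_eq_coe {Ω : X → EReal} {xb : X} {ξ : X →L[ℝ] ℝ}
    (hsub : IsSubgradient Ω xb ξ) (hproper : IsProper Ω) : ∃ b : ℝ, Ω xb = b := by
  obtain ⟨hbot, z, hz⟩ := hproper
  refine ⟨(Ω xb).toReal, (EReal.coe_toReal (fun htop => hz ?_) (hbot xb)).symm⟩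
  have hle := hsub z
  rwa [htop, EReal.top_add_coe, top_le_iff] at hle

/-- A subgradient of the form `A*η` at `xb` makes `xb` a maximizer of
`x ↦ Ω(x†) − Ω(x) + ⟨η, A x − A x†⟩`. -/
theorem IsSubgradient.sub_add_le {A : X →L[ℝ] Y} {Ω : X → EReal} {xdag xb : X}
    {η : Y →L[ℝ] ℝ} (hsub : IsSubgradient Ω xb (η.comp A)) (hproper : IsProper Ω)
    (hdag : Ω xdag ≠ ⊤) (x : X) :
    Ω xdag - Ω x + (η (A x - A xdag) : EReal) ≤
      Ω xdag - Ω xb + (η (A xb - A xdag) : EReal) := by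
  obtain ⟨b, hb⟩ := hsub.exists_eq_coe hproper
  have hx := hsub x
  have hxbot := hproper.1 x
  lift Ω xdag to ℝ using ⟨hdag, hproper.1 xdag⟩ with d
  rw [hb] at hx ⊢
  induction hΩ : Ω x with
  | bot => exact absurd hΩ hxbot
  | top => simp
  | coe c =>
    rw [hΩ] at hx
    norm_cast at hx ⊢
    simp only [ContinuousLinearMap.comp_apply, map_sub] at hx ⊢
    linarith

/-- The Bregman distance for `A*η`, with the linear term written in the image space. -/
theorem bregman_comp_eq (A : X →L[ℝ] Y) (Ω : X → EReal) (xdag xb : X) (η : Y →L[ℝ] ℝ) :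
    Bregman Ω (η.comp A) xdag xb = Ω xdag - Ω xb + (η (A xb - A xdag) : EReal) := by
  rw [Bregman, sub_eq_add_neg _ ((_ : ℝ) : EReal), ← EReal.coe_neg]
  simp

/-- if `A*η ∈ ∂Ω(x̄)`, then `D(‖η‖) ≤ B^Ω_{A*η}(x†, x̄)`, and the
supremum `sup_{x∈X} (Ω(x†) − Ω(x) + ⟨η, A x − A x†⟩)` is attained at `x = x̄`. -/
theorem distFun_le_skewed_bregman (A : X →L[ℝ] Y) (ydag : Y) (Ω : X → EReal)
    (hproper : IsProper Ω) (hconv : IsConvexFn Ω)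
    (xdag : X) (hmin : IsOmegaMinSol A ydag Ω xdag)
    (xb : X) (η : Y →L[ℝ] ℝ) (hsub : IsSubgradient Ω xb (η.comp A)) :
    distFun A Ω xdag ‖η‖ ≤ Bregman Ω (η.comp A) xdag xb ∧
      (⨆ x : X, (Ω xdag - Ω x + (η (A x - A xdag) : EReal))) =
        Ω xdag - Ω xb + (η (A xb - A xdag) : EReal) := by
  have hle := hsub.sub_add_le hproper hmin.2.1
  refine ⟨?_, le_antisymm (iSup_le hle)
    (le_iSup (fun x => Ω xdag - Ω x + (η (A x - A xdag) : EReal)) xb)⟩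
  rw [bregman_comp_eq]
  refine iSup_le fun x => le_trans ?_ (hle x)
  rw [sub_eq_add_neg _ ((_ : ℝ) : EReal), ← EReal.coe_neg]
  gcongr
  exact neg_le_of_abs_le (η.le_opNorm (A x - A xdag))
end
end

section
/- Let x† be an Ω-minimizing solution of A x = y†, assume D(r) = sup_{x∈X} (Ω(x†) − Ω(x) − r·‖A x − A x†‖) is finite-valued with D(r) > 0 for all r ≥ 0 and lim_{r→∞} D(r) = 0, and let Φ(r) = D(r)/r with inverse Φ^{-1} : (0,∞) → (0,∞). Let c₁ > 0, let δ > 0, ‖y^δ − y†‖ ≤ δ, and let α satisfy α ≥ c₁·δ^p/D(Φ^{-1}(δ)). Let x* be a minimizer of T_α^δ and η ∈ Y* satisfy ⟨η, A x* − y^δ⟩ = −‖η‖·‖A x* − y^δ‖, α·‖η‖ = ‖A x* − y^δ‖^{p−1} and A*η ∈ ∂Ω(x*). Then ‖η‖ ≤ (1/c₁ + 4p)·Φ^{-1}(δ). -/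
open Filter Topology Set

noncomputable section

variable {X Y : Type*} [NormedAddCommGroup X] [NormedSpace ℝ X] [CompleteSpace X]
  [NormedAddCommGroup Y] [NormedSpace ℝ Y] [CompleteSpace Y]

/-- Comparing a Tikhonov minimizer with a point `x` at which `Ω` is finite, in real numbers. -/
theorem exists_real_tikhonov_comparison {E F : Type*} [NormedAddCommGroup E] [NormedSpace ℝ E]
    [NormedAddCommGroup F] [NormedSpace ℝ F] (A : E →L[ℝ] F) {Ω : E → EReal}
    (hΩ : ∀ x, Ω x ≠ ⊥) {yδ : F} {p α : ℝ} (hα : 0 < α) {xs x : E} (hx : Ω x ≠ ⊤)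
    (hle : Tikhonov A yδ p α Ω xs ≤ Tikhonov A yδ p α Ω x) :
    ∃ a b : ℝ, Ω xs = a ∧ Ω x = b ∧
      1 / p * ‖A xs - yδ‖ ^ p + α * a ≤ 1 / p * ‖A x - yδ‖ ^ p + α * b := by
  obtain ⟨b, hb⟩ : ∃ b : ℝ, Ω x = b := ⟨_, (EReal.coe_toReal hx (hΩ x)).symm⟩
  unfold Tikhonov at hle
  rw [hb] at hle
  have htop : Ω xs ≠ ⊤ := by
    intro h
    rw [h, EReal.coe_mul_top_of_pos hα, EReal.coe_add_top, top_le_iff] at hle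
    exact EReal.coe_ne_top _ (by exact_mod_cast hle)
  obtain ⟨a, ha⟩ : ∃ a : ℝ, Ω xs = a := ⟨_, (EReal.coe_toReal htop (hΩ xs)).symm⟩
  rw [ha] at hle
  exact ⟨a, b, ha, hb, by exact_mod_cast hle⟩

/-- under the a priori lower bound `α ≥ c₁ δ^p / D(Φ⁻¹(δ))`, the
dual element `η` from the optimality condition satisfies
`‖η‖ ≤ (1/c₁ + 4p) Φ⁻¹(δ)`. -/
theorem eta_norm_bound (A : X →L[ℝ] Y) (ydag : Y) (Ω : X → EReal)
    (hproper : IsProper Ω) (hconv : IsConvexFn Ω)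
    (p : ℝ) (hp : 1 < p)
    (xdag : X) (hmin : IsOmegaMinSol A ydag Ω xdag)
    (D : ℝ → ℝ) (hD : ∀ r, 0 ≤ r → (D r : EReal) = distFun A Ω xdag r)
    (hpos : ∀ r, 0 ≤ r → 0 < D r)
    (hlim : Tendsto D atTop (𝓝 0))
    (Φinv : ℝ → ℝ) (hΦinv : ∀ t, 0 < t → 0 < Φinv t ∧ D (Φinv t) / Φinv t = t)
    (c₁ : ℝ) (hc₁ : 0 < c₁)
    (δ : ℝ) (hδ : 0 < δ) (yδ : Y) (hnoise : ‖yδ - ydag‖ ≤ δ)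
    (α : ℝ) (hα : 0 < α) (hαge : c₁ * δ ^ p / D (Φinv δ) ≤ α)
    (xs : X) (hxs : ∀ x, Tikhonov A yδ p α Ω xs ≤ Tikhonov A yδ p α Ω x)
    (η : Y →L[ℝ] ℝ) (hη : EtaCondition A yδ p α Ω xs η) :
    ‖η‖ ≤ (1 / c₁ + 4 * p) * Φinv δ := by
  obtain ⟨hA, hfin, -⟩ := hmin
  obtain ⟨-, hηα, -⟩ := hη
  obtain ⟨hr, hΦ⟩ := hΦinv δ hδ
  have hDr := hD _ hr.le
  generalize Φinv δ = r at *
  have hDδ : D r = r * δ := by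
    rw [div_eq_iff hr.ne'] at hΦ
    linarith
  obtain ⟨a, b, ha, hb, hab⟩ :=
    exists_real_tikhonov_comparison A hproper.1 hα hfin (hxs xdag)
  have hdist : b - a - r * ‖A xs - A xdag‖ ≤ D r := by
    have h : Ω xdag - Ω xs - ((r * ‖A xs - A xdag‖ : ℝ) : EReal) ≤ D r := by
      rw [hDr]
      exact le_iSup (fun x => Ω xdag - Ω x - ((r * ‖A x - A xdag‖ : ℝ) : EReal)) xs
    rw [ha, hb] at h
    exact_mod_cast h
  rw [hA] at hdist hab
  rw [norm_sub_rev ydag yδ] at hab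
  have htri : ‖A xs - ydag‖ ≤ ‖A xs - yδ‖ + δ :=
    (norm_sub_le_norm_sub_add_norm_sub _ yδ _).trans (by gcongr)
  have hp0 : 0 < p := by linarith
  have hnp : ‖yδ - ydag‖ ^ p ≤ δ ^ p := by gcongr
  have hδp : δ ^ p = δ ^ (p - 1) * δ := by
    rw [← Real.rpow_add_one hδ.ne', sub_add_cancel]
  have hδα : δ ^ (p - 1) ≤ α * (r / c₁) := by
    rw [hDδ, hδp, div_le_iff₀ (by positivity)] at hαge
    have : c₁ * δ ^ (p - 1) ≤ α * r := by nlinarith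
    rw [← mul_div_assoc, le_div_iff₀ hc₁]
    linarith
  have hρ0 : 0 ≤ ‖A xs - yδ‖ := norm_nonneg _
  generalize ‖A xs - yδ‖ = ρ at *
  suffices h : ρ ^ (p - 1) ≤ δ ^ (p - 1) + 3 * p * α * r by
    have h2 : α * ‖η‖ ≤ α * ((1 / c₁ + 4 * p) * r) := by
      have : 0 ≤ p * α * r := by positivity
      calc α * ‖η‖ ≤ α * (r / c₁) + 4 * (p * α * r) := by linarith
        _ = _ := by ring
    exact le_of_mul_le_mul_left h2 hα
  have hpαr : 0 < p * α * r := by positivity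
  rcases le_total ρ δ with hρ | hρ
  · have : ρ ^ (p - 1) ≤ δ ^ (p - 1) := by
      gcongr
    linarith
  · have hρ0 : 0 < ρ := hδ.trans_le hρ
    have hgap : b - a ≤ 3 * r * ρ := by nlinarith
    have hρp : ρ ^ p = ρ ^ (p - 1) * ρ := by
      rw [← Real.rpow_add_one hρ0.ne', sub_add_cancel]
    have hmain : ρ ^ p ≤ δ ^ p + p * α * (b - a) := by
      have h := mul_le_mul_of_nonneg_left hab hp0.le
      have h1 : ∀ t c : ℝ, p * (1 / p * t + c) = t + p * c := fun t c => by field_simp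
      rw [h1, h1] at h
      linarith
    have hgap' : p * α * (b - a) ≤ p * α * (3 * r * ρ) := by gcongr
    have hδρ : δ ^ (p - 1) * δ ≤ δ ^ (p - 1) * ρ := by gcongr
    refine le_of_mul_le_mul_right ?_ hρ0
    linarith
end
end

section
/- (Converse result.) Let x† be an Ω-minimizing solution of A x = y†, assume D(r) = sup_{x∈X} (Ω(x†) − Ω(x) − r·‖A x − A x†‖) is finite-valued with D(r) > 0 for all r ≥ 0 and lim_{r→∞} D(r) = 0, and let Φ(r) = D(r)/r with inverse Φ^{-1} : (0,∞) → (0,∞). Let c₁, c₂ > 0. Then there exists a constant c > 0 (one may take c = 1/c₁ + 4p) such that for all δ > 0, all data y^δ with ‖y^δ − y†‖ ≤ δ, all α with c₁·δ^p/D(Φ^{-1}(δ)) ≤ α ≤ c₂·δ^p/D(Φ^{-1}(δ)), every minimizer x* of T_α^δ, and every η ∈ Y* satisfying ⟨η, A x* − y^δ⟩ = −‖η‖·‖A x* − y^δ‖, α·‖η‖ = ‖A x* − y^δ‖^{p−1} and A*η ∈ ∂Ω(x*), one has the lower bound D(c·Φ^{-1}(δ)) ≤ B^Ω_{A*η}(x†,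 x*). -/
open Filter Topology Set

noncomputable section

variable {X Y : Type*} [NormedAddCommGroup X] [NormedSpace ℝ X] [CompleteSpace X]
  [NormedAddCommGroup Y] [NormedSpace ℝ Y] [CompleteSpace Y]

omit [CompleteSpace X] [CompleteSpace Y] in
/-- A subgradient `A*η` at `xs` with `‖η‖ ≤ r` bounds the distance function at `r` by the
Bregman distance. -/
theorem distFun_le_bregman (A : X →L[ℝ] Y) {Ω : X → EReal} (hbot : ∀ x, Ω x ≠ ⊥)
    {xdag xs : X} {η : Y →L[ℝ] ℝ} (hdag : Ω xdag ≠ ⊤) (hs : Ω xs ≠ ⊤)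
    (hη : IsSubgradient Ω xs (η.comp A)) {r : ℝ} (hr : ‖η‖ ≤ r) :
    distFun A Ω xdag r ≤ Bregman Ω (η.comp A) xdag xs := by
  refine iSup_le fun x => ?_
  have hx := hη x
  unfold Bregman
  lift Ω xdag to ℝ using ⟨hdag, hbot xdag⟩ with a
  lift Ω xs to ℝ using ⟨hs, hbot xs⟩ with b
  by_cases hxtop : Ω x = ⊤
  · simp [hxtop]
  lift Ω x to ℝ using ⟨hxtop, hbot x⟩ with w
  norm_cast at hx ⊢
  simp only [ContinuousLinearMap.comp_apply, map_sub] at hx ⊢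
  have hle : -(η (A x - A xdag)) ≤ r * ‖A x - A xdag‖ :=
    (neg_le_abs _).trans <| (η.le_opNorm _).trans <| by gcongr
  rw [map_sub] at hle
  linarith

omit [CompleteSpace X] [CompleteSpace Y] in
/-- The distance function controls the loss `Ω(x†) − Ω(x)`. -/
theorem sub_le_add_mul_norm_of_distFun {A : X →L[ℝ] Y} {Ω : X → EReal} {xdag x : X}
    {a b d r : ℝ} (ha : Ω xdag = a) (hb : Ω x = b) (hd : (d : EReal) = distFun A Ω xdag r) :
    a - b ≤ d + r * ‖A x - A xdag‖ := by
  have h := le_iSup (fun x : X => Ω xdag - Ω x - ((r * ‖A x - A xdag‖ : ℝ) : EReal)) x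
  change _ ≤ distFun A Ω xdag r at h
  rw [← hd, ha, hb] at h
  norm_cast at h
  linarith

theorem rpow_sub_one_le_of_rpow_le {p δ t k : ℝ} (hp : 1 < p) (hδ : 0 < δ) (ht : 0 ≤ t)
    (hk : 0 ≤ k) (h : t ^ p ≤ δ ^ p + k * δ ^ (p - 1) * (2 * δ + t)) :
    t ^ (p - 1) ≤ (1 + 3 * k) * δ ^ (p - 1) := by
  have hδp : 0 < δ ^ (p - 1) := Real.rpow_pos_of_pos hδ _
  rcases le_or_gt t δ with htδ | htδ
  · have := Real.rpow_le_rpow ht htδ (by linarith : 0 ≤ p - 1)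
    nlinarith [mul_nonneg hk hδp.le]
  · have ht0 : 0 < t := hδ.trans htδ
    have split {s : ℝ} (hs : 0 < s) : s ^ p = s ^ (p - 1) * s := by
      rw [← Real.rpow_add_one hs.ne', sub_add_cancel]
    rw [split ht0, split hδ] at h
    refine le_of_mul_le_mul_right (h.trans ?_) ht0
    nlinarith [mul_nonneg hδp.le (sub_nonneg.2 htδ.le),
      mul_nonneg (mul_nonneg hk hδp.le) (sub_nonneg.2 htδ.le)]

/-- Theorem 2, converse result: there is a constant `c > 0`
(one may take `c = 1/c₁ + 4p`) such that for the a priori parameter choice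
`c₁ δ^p/D(Φ⁻¹(δ)) ≤ α ≤ c₂ δ^p/D(Φ⁻¹(δ))` one has the lower bound
`D(c Φ⁻¹(δ)) ≤ B^Ω_{A*η}(x†, xs)`. -/
theorem converse_lower_bound (A : X →L[ℝ] Y) (ydag : Y) (Ω : X → EReal)
    (hproper : IsProper Ω) (hconv : IsConvexFn Ω)
    (p : ℝ) (hp : 1 < p)
    (xdag : X) (hmin : IsOmegaMinSol A ydag Ω xdag)
    (D : ℝ → ℝ) (hD : ∀ r, 0 ≤ r → (D r : EReal) = distFun A Ω xdag r)
    (hpos : ∀ r, 0 ≤ r → 0 < D r)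
    (hlim : Tendsto D atTop (𝓝 0))
    (Φinv : ℝ → ℝ) (hΦinv : ∀ t, 0 < t → 0 < Φinv t ∧ D (Φinv t) / Φinv t = t)
    (c₁ c₂ : ℝ) (hc₁ : 0 < c₁) (hc₂ : 0 < c₂) :
    ∃ c : ℝ, 0 < c ∧
      ∀ δ : ℝ, 0 < δ → ∀ yδ : Y, ‖yδ - ydag‖ ≤ δ →
        ∀ α : ℝ, c₁ * δ ^ p / D (Φinv δ) ≤ α → α ≤ c₂ * δ ^ p / D (Φinv δ) →
          ∀ xs : X, (∀ x, Tikhonov A yδ p α Ω xs ≤ Tikhonov A yδ p α Ω x) →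
            ∀ η : Y →L[ℝ] ℝ, EtaCondition A yδ p α Ω xs η →
              ((D (c * Φinv δ) : ℝ) : EReal) ≤ Bregman Ω (η.comp A) xdag xs := by
  have hK : 0 < 1 + 3 * (p * c₂) := by positivity
  refine ⟨(1 + 3 * (p * c₂)) / c₁, by positivity, ?_⟩
  rintro δ hδ yδ hyδ α hα₁ hα₂ xs hxs η ⟨-, hη, hsub⟩
  obtain ⟨hR, hDR⟩ := hΦinv δ hδ
  set R := Φinv δ
  obtain ⟨hA, hdag, -⟩ := hmin
  rw [div_eq_iff hR.ne'] at hDR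
  have hδp : 0 < δ ^ (p - 1) := Real.rpow_pos_of_pos hδ _
  have hquot (c : ℝ) : c * δ ^ p / D R = c * δ ^ (p - 1) / R := by
    rw [hDR, ← sub_add_cancel p 1, Real.rpow_add_one hδ.ne']
    field_simp
    simp
  rw [hquot] at hα₁ hα₂
  have hα : 0 < α := lt_of_lt_of_le (by positivity) hα₁
  rw [div_le_iff₀ hR] at hα₁
  rw [le_div_iff₀ hR] at hα₂
  have hs : Ω xs ≠ ⊤ := by
    intro htop
    have := hsub xdag
    rw [htop, EReal.top_add_coe, top_le_iff] at this
    exact hdag this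
  rw [hD _ (by positivity)]
  refine distFun_le_bregman A hproper.1 hdag hs hsub ?_
  set t := ‖A xs - yδ‖
  have ht : 0 ≤ t := norm_nonneg _
  obtain ⟨a, ha⟩ : ∃ a : ℝ, Ω xdag = a := ⟨_, (EReal.coe_toReal hdag (hproper.1 _)).symm⟩
  obtain ⟨b, hb⟩ : ∃ b : ℝ, Ω xs = b := ⟨_, (EReal.coe_toReal hs (hproper.1 _)).symm⟩
  have hab := sub_le_add_mul_norm_of_distFun ha hb (hD R hR.le)
  have hnorm : ‖A xs - A xdag‖ ≤ t + δ := by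
    rw [hA]
    exact (norm_sub_le_norm_sub_add_norm_sub _ yδ _).trans (by gcongr)
  have hT := hxs xdag
  simp only [Tikhonov, ha, hb] at hT
  norm_cast at hT
  have hdata : ‖A xdag - yδ‖ ^ p ≤ δ ^ p := by
    rw [hA, norm_sub_rev]
    gcongr
  have hgap : a - b ≤ R * (2 * δ + t) := by
    nlinarith [mul_le_mul_of_nonneg_left hnorm hR.le]
  have hαgap : α * (a - b) ≤ c₂ * δ ^ (p - 1) * (2 * δ + t) :=
    calc α * (a - b) ≤ α * (R * (2 * δ + t)) := by gcongr
      _ = α * R * (2 * δ + t) := by ring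
      _ ≤ _ := by gcongr
  have hres : t ^ p ≤ δ ^ p + p * c₂ * δ ^ (p - 1) * (2 * δ + t) := by
    have h : t ^ p ≤ ‖A xdag - yδ‖ ^ p + p * (α * (a - b)) := by
      have h' : 1 / p * t ^ p ≤ 1 / p * ‖A xdag - yδ‖ ^ p + α * (a - b) := by linarith
      have hp0 : 0 < p := by linarith
      field_simp at h'
      linarith
    have := mul_le_mul_of_nonneg_left hαgap (by linarith : 0 ≤ p)
    linarith
  have hbound := rpow_sub_one_le_of_rpow_le hp hδ ht (by positivity) hres
  refine le_of_mul_le_mul_left ?_ hα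
  rw [hη]
  calc t ^ (p - 1) ≤ (1 + 3 * (p * c₂)) * δ ^ (p - 1) := hbound
    _ = (1 + 3 * (p * c₂)) / c₁ * (c₁ * δ ^ (p - 1)) := by field_simp
    _ ≤ (1 + 3 * (p * c₂)) / c₁ * (α * R) := by gcongr
    _ = α * ((1 + 3 * (p * c₂)) / c₁ * R) := by ring
end
end

section
/- Let x† be an Ω-minimizing solution of A x = y†, assume D(r) = sup_{x∈X} (Ω(x†) − Ω(x) − r·‖A x − A x†‖) is finite-valued with D(r) > 0 for all r ≥ 0 and lim_{r→∞} D(r) = 0, and let Φ(r) = D(r)/r with inverse Φ^{-1} : (0,∞) → (0,∞). Let c₁, c₂ > 0. Then there exists a constant C > 0 such that for all δ > 0, all data y^δ with ‖y^δ − y†‖ ≤ δ, all α with c₁·δ^p/D(Φ^{-1}(δ)) ≤ α ≤ c₂·δ^p/D(Φ^{-1}(δ)), every minimizer x* of T_α^δ, and every η ∈ Y* satisfying ⟨η, A x* − y^δ⟩ = −‖η‖·‖A x* − y^δ‖, α·‖η‖ = ‖A x* − y^δ‖^{p−1} and A*η ∈ ∂Ω(x*), one has the upper bound B^Ω_{A*η}(x†,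 x*) ≤ C·D(Φ^{-1}(δ)). -/
open Filter Topology Set

noncomputable section

variable {X Y : Type*} [NormedAddCommGroup X] [NormedSpace ℝ X] [CompleteSpace X]
  [NormedAddCommGroup Y] [NormedSpace ℝ Y] [CompleteSpace Y]

/-- A minimizing pair of discrepancy `R` and dual norm `n` with `α n = R ^ (p - 1)` satisfies the
error estimate at the order of `r δ` as soon as `α r` is comparable to `δ ^ (p - 1)`. -/
theorem discrepancy_estimate {p c₁ c₂ K δ r α R n : ℝ} (hp : 1 < p) (hc₁ : 0 < c₁)
    (hK : 2 ≤ K) (hKc : 2 * c₂ ≤ K ^ (p - 1)) (hδ : 0 < δ) (hr : 0 < r) (hα : 0 < α)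
    (hR : 0 ≤ R) (hn : 0 ≤ n) (hnR : α * n = R ^ (p - 1))
    (hlower : c₁ * δ ^ (p - 1) ≤ α * r) (hupper : α * r ≤ c₂ * δ ^ (p - 1)) :
    2 * (r * δ) + r * R + n * (δ - R) ≤ (2 + K + K ^ (p - 1) / c₁) * (r * δ) := by
  have hp' : 0 ≤ p - 1 := by linarith
  have hK0 : 0 ≤ K := by linarith
  have hδp : 0 < δ ^ (p - 1) := Real.rpow_pos_of_pos hδ _
  rcases le_or_gt R (K * δ) with h | h
  · have hRp : R ^ (p - 1) ≤ K ^ (p - 1) * δ ^ (p - 1) := by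
      rw [← Real.mul_rpow hK0 hδ.le]
      exact Real.rpow_le_rpow hR h hp'
    have hnc : n * c₁ ≤ K ^ (p - 1) * r := by
      refine le_of_mul_le_mul_right ?_ hδp
      calc n * c₁ * δ ^ (p - 1) = n * (c₁ * δ ^ (p - 1)) := by ring
        _ ≤ n * (α * r) := by gcongr
        _ = α * n * r := by ring
        _ ≤ K ^ (p - 1) * δ ^ (p - 1) * r := by rw [hnR]; gcongr
        _ = K ^ (p - 1) * r * δ ^ (p - 1) := by ring
    have hnδ : n * δ ≤ K ^ (p - 1) / c₁ * (r * δ) := by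
      have hle : n ≤ K ^ (p - 1) * r / c₁ := (le_div_iff₀ hc₁).2 hnc
      calc n * δ ≤ K ^ (p - 1) * r / c₁ * δ := by gcongr
        _ = K ^ (p - 1) / c₁ * (r * δ) := by ring
    have hrR : r * R ≤ r * (K * δ) := by gcongr
    linarith [mul_nonneg hn hR]
  · have hrn : 2 * r ≤ n := by
      refine le_of_mul_le_mul_left ?_ hα
      have hRp : K ^ (p - 1) * δ ^ (p - 1) ≤ R ^ (p - 1) := by
        rw [← Real.mul_rpow hK0 hδ.le]
        exact Real.rpow_le_rpow (by positivity) h.le hp'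
      linarith [mul_le_mul_of_nonneg_right hKc hδp.le]
    have hδR : 2 * δ ≤ R := (mul_le_mul_of_nonneg_right hK hδ.le).trans h.le
    have hC : 0 ≤ (K + K ^ (p - 1) / c₁) * (r * δ) := by positivity
    linarith [mul_nonneg hn (sub_nonneg.2 hδR), mul_nonneg (sub_nonneg.2 hrn) hR]

/-- The functional is finite at every point with a subgradient, provided it is finite somewhere. -/
theorem IsSubgradient.ne_top {E : Type*} [NormedAddCommGroup E] [NormedSpace ℝ E]
    {Ω : E → EReal} {x z : E} {ξ : E →L[ℝ] ℝ}
    (h : IsSubgradient Ω x ξ) (hz : Ω z ≠ ⊤) : Ω x ≠ ⊤ := by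
  intro hx
  have hxz := h z
  rw [hx, EReal.top_add_coe, top_le_iff] at hxz
  exact hz hxz

/-- upper rate with the rate function `D ∘ Φ⁻¹`: there is `C > 0`
such that for the a priori parameter choice
`c₁ δ^p/D(Φ⁻¹(δ)) ≤ α ≤ c₂ δ^p/D(Φ⁻¹(δ))` one has
`B^Ω_{A*η}(x†, xs) ≤ C·D(Φ⁻¹(δ))`. -/
theorem upper_bound_rate (A : X →L[ℝ] Y) (ydag : Y) (Ω : X → EReal)
    (hproper : IsProper Ω) (hconv : IsConvexFn Ω)
    (p : ℝ) (hp : 1 < p)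
    (xdag : X) (hmin : IsOmegaMinSol A ydag Ω xdag)
    (D : ℝ → ℝ) (hD : ∀ r, 0 ≤ r → (D r : EReal) = distFun A Ω xdag r)
    (hpos : ∀ r, 0 ≤ r → 0 < D r)
    (hlim : Tendsto D atTop (𝓝 0))
    (Φinv : ℝ → ℝ) (hΦinv : ∀ t, 0 < t → 0 < Φinv t ∧ D (Φinv t) / Φinv t = t)
    (c₁ c₂ : ℝ) (hc₁ : 0 < c₁) (hc₂ : 0 < c₂) :
    ∃ C : ℝ, 0 < C ∧
      ∀ δ : ℝ, 0 < δ → ∀ yδ : Y, ‖yδ - ydag‖ ≤ δ →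
        ∀ α : ℝ, c₁ * δ ^ p / D (Φinv δ) ≤ α → α ≤ c₂ * δ ^ p / D (Φinv δ) →
          ∀ xs : X, (∀ x, Tikhonov A yδ p α Ω xs ≤ Tikhonov A yδ p α Ω x) →
            ∀ η : Y →L[ℝ] ℝ, EtaCondition A yδ p α Ω xs η →
              Bregman Ω (η.comp A) xdag xs ≤ ((C * D (Φinv δ) : ℝ) : EReal) := by
  have hK2 : (2 : ℝ) ≤ max 2 ((2 * c₂) ^ (p - 1)⁻¹) := le_max_left _ _
  have hKc : 2 * c₂ ≤ max 2 ((2 * c₂) ^ (p - 1)⁻¹) ^ (p - 1) :=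
    (Real.rpow_inv_le_iff_of_pos (by positivity) (by positivity) (by linarith)).1
      (le_max_right _ _)
  generalize max 2 ((2 * c₂) ^ (p - 1)⁻¹) = K at hK2 hKc
  refine ⟨2 + K + K ^ (p - 1) / c₁, by positivity, ?_⟩
  rintro δ hδ yδ hyδ α hα₁ hα₂ xs - η ⟨hη, hαη, hsub⟩
  obtain ⟨hr, hΦ⟩ := hΦinv δ hδ
  have hDr := hD (Φinv δ) hr.le
  generalize Φinv δ = r at *
  have hd : D r = r * δ := by rw [← hΦ]; field_simp
  have hsup : Ω xdag - Ω xs - ((r * ‖A xs - A xdag‖ : ℝ) : EReal) ≤ (D r : EReal) :=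
    hDr ▸ le_iSup (fun x => Ω xdag - Ω x - ((r * ‖A x - A xdag‖ : ℝ) : EReal)) xs
  rw [hd] at hα₁ hα₂ hsup ⊢
  have hquot (c : ℝ) : c * δ ^ p / (r * δ) = c * δ ^ (p - 1) / r := by
    rw [Real.rpow_sub_one hδ.ne']; field_simp
  rw [hquot] at hα₁ hα₂
  have hδp : 0 < δ ^ (p - 1) := Real.rpow_pos_of_pos hδ _
  have hα : 0 < α := lt_of_lt_of_le (by positivity) hα₁
  have hest := discrepancy_estimate hp hc₁ hK2 hKc hδ hr hα (norm_nonneg (A xs - yδ))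
    (norm_nonneg η) hαη ((div_le_iff₀ hr).1 hα₁) ((le_div_iff₀ hr).1 hα₂)
  obtain ⟨hAx, hxdag, -⟩ := hmin
  have hxs := hsub.ne_top hxdag
  unfold Bregman
  lift Ω xdag to ℝ using ⟨hxdag, hproper.1 xdag⟩ with a
  lift Ω xs to ℝ using ⟨hxs, hproper.1 xs⟩ with b
  norm_cast at hsup ⊢
  refine le_trans ?_ hest
  have hresid : ‖A xs - A xdag‖ ≤ ‖A xs - yδ‖ + δ := by
    rw [hAx, ← sub_add_sub_cancel (A xs) yδ ydag]
    exact (norm_add_le _ _).trans (by gcongr)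
  have hdual : η (yδ - A xdag) ≤ ‖η‖ * δ := by
    rw [hAx]
    exact (le_abs_self _).trans (η.le_opNorm_of_le hyδ)
  have hsplit : (η.comp A) (xdag - xs) = -η (A xs - yδ) - η (yδ - A xdag) := by
    simp only [ContinuousLinearMap.comp_apply, map_sub]
    ring
  rw [hsplit, hη]
  linarith [mul_le_mul_of_nonneg_left hresid hr.le]
end
end

section
/- (Noise-free identity.) Let x† be an Ω-minimizing solution of A x = y† and let D(r) = sup_{x∈X} (Ω(x†) − Ω(x) − r·‖A x − A x†‖). Let α > 0, let x* be a minimizer over X of the noise-free Tikhonov functional x ↦ (1/p)‖A x − y†‖^p + α Ω(x), and let η ∈ Y* satisfy ⟨η, A x* − y†⟩ = −‖η‖·‖A x* − y†‖, α·‖η‖ = ‖A x* − y†‖^{p−1} and A*η ∈ ∂Ω(x*). Then D(‖η‖) = B^Ω_{A*η}(x†, x*). -/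
open Filter Topology Set

noncomputable section

variable {X Y : Type*} [NormedAddCommGroup X] [NormedSpace ℝ X] [CompleteSpace X]
  [NormedAddCommGroup Y] [NormedSpace ℝ Y] [CompleteSpace Y]

/-- noise-free identity: for a minimizer `xs` of the noise-free
Tikhonov functional (data `y† = A x†`) with optimality element `η`, one has
`D(‖η‖) = B^Ω_{A*η}(x†, xs)`. -/
theorem noise_free_identity (A : X →L[ℝ] Y) (ydag : Y) (Ω : X → EReal)
    (hproper : IsProper Ω) (hconv : IsConvexFn Ω)
    (p α : ℝ) (hp : 1 < p) (hα : 0 < α)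
    (xdag : X) (hmin : IsOmegaMinSol A ydag Ω xdag)
    (xs : X) (hxs : ∀ x, Tikhonov A ydag p α Ω xs ≤ Tikhonov A ydag p α Ω x)
    (η : Y →L[ℝ] ℝ) (hη : EtaCondition A ydag p α Ω xs η) :
    distFun A Ω xdag ‖η‖ = Bregman Ω (η.comp A) xdag xs := by
  obtain ⟨hη₁, -, hsub⟩ := hη
  obtain ⟨hA, hdag_top, -⟩ := hmin
  subst hA
  have hxs_top : Ω xs ≠ ⊤ := fun h => by
    have := hsub xdag
    rw [h, EReal.top_add_coe] at this
    exact hdag_top (top_le_iff.mp this)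
  obtain ⟨d, hd⟩ : ∃ d : ℝ, Ω xdag = d :=
    ⟨_, (EReal.coe_toReal hdag_top (hproper.1 xdag)).symm⟩
  obtain ⟨s, hs⟩ : ∃ s : ℝ, Ω xs = s :=
    ⟨_, (EReal.coe_toReal hxs_top (hproper.1 xs)).symm⟩
  have hpair : (η.comp A) (xdag - xs) = ‖η‖ * ‖A xs - A xdag‖ := by
    rw [ContinuousLinearMap.comp_apply, map_sub, ← neg_sub, map_neg, hη₁, neg_neg]
  rw [distFun, Bregman, hpair]
  refine le_antisymm (iSup_le fun x => ?_)
    (le_iSup (fun x => Ω xdag - Ω x - ((‖η‖ * ‖A x - A xdag‖ : ℝ) : EReal)) xs)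
  by_cases hx_top : Ω x = ⊤
  · simp [hx_top, hd]
  obtain ⟨w, hw⟩ : ∃ w : ℝ, Ω x = w :=
    ⟨_, (EReal.coe_toReal hx_top (hproper.1 x)).symm⟩
  have hsubx := hsub x
  rw [hs, hw] at hsubx
  norm_cast at hsubx
  rw [hd, hs, hw]
  norm_cast
  have hsplit : (η.comp A) (x - xs) = η (A x - A xdag) - η (A xs - A xdag) := by
    simp
  have hop : -η (A x - A xdag) ≤ ‖η‖ * ‖A x - A xdag‖ :=
    (neg_le_abs _).trans (η.le_opNorm _)
  linarith
end
end
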